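/- arXiv:2309.15364 — 2 statements merged into one kernel-verified Lean document; each statement's English description precedes it below -/
import Mathlib

section
/- Let F = ℚ(q,z,α,β,w) be the field of rational functions over ℚ in the indeterminates q, z, α, β, w. For a ∈ F, parameters e₁,…,e₇ ∈ F and an upper limit S ∈ ℕ, define the terminating very-well-poised sum W_S(a; e₁,…,e₇) := Σ_{s=0}^{S} (1 − a q^{2s})/(1 − a) · (a;q)_s q^{s}/(q;q)_s · ∏_{r=1}^{7} (e_r;q)_s/(qa/e_r;q)_s. Then for all n, i, j ∈ ℕ with i ≤ n and j ≤ n: W_{min(i,j)}(q^{−n}z/α; q^{−i}, q^{−j}, q^{−n+i}w/α, q^{−n+j}β/w, z/(αβ), qz/α, q^{−n+1}z) = P · W_{min(n−i,n−j)}(q^{−n}z/β; q^{−n+i}, q^{−n+j}, q^{−i}α/w, q^{−j}w/β, z/(αβ), qz/β, q^{−n+1}z), where P := (1/α;q)_n (1/β;q)_n (w/z;q)_n (αβ/(zw);q)_n / ((α/z;q)_n (β/z;q)_n (1/w;q)_n (w/(αβ);q)_n) · (β/z;q)_i (w/(αβ);q)_i (q^{−n+1}z/α;q)_i (q^{−n+1}w;q)_i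 / ((1/α;q)_i (w/z;q)_i (q^{−n+1}β;q)_i (q^{−n+1}zw/(αβ);q)_i) · (β/z;q)_j (1/w;q)_j (q^{−n+1}z/α;q)_j (q^{−n+1}αβ/w;q)_j / ((1/α;q)_j (αβ/(zw);q)_j (q^{−n+1}β;q)_j (q^{−n+1}z/w;q)_j). -/
open Finset

/-- The `q`-shifted factorial `(a;q)_n = ∏_{i=0}^{n-1} (1 - a q^i)`. -/
noncomputable def qPoch {F : Type*} [Field F] (q a : F) (n : ℕ) : F :=
  ∏ i ∈ Finset.range n, (1 - a * q ^ i)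

/-- The terminating very-well-poised sum
`W_S(a; e₁,…,e₇) = Σ_{s=0}^{S} (1-aq^{2s})/(1-a) (a;q)_s q^s/(q;q)_s
   ∏_{r=1}^{7} (e_r;q)_s/(qa/e_r;q)_s`. -/
noncomputable def vwpW {F : Type*} [Field F] (q a e₁ e₂ e₃ e₄ e₅ e₆ e₇ : F) (S : ℕ) : F :=
  ∑ s ∈ Finset.range (S + 1),
    (1 - a * q ^ (2 * s)) / (1 - a) * qPoch q a s * q ^ s / qPoch q q s *
      (qPoch q e₁ s / qPoch q (q * a / e₁) s) * (qPoch q e₂ s / qPoch q (q * a / e₂) s) *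
      (qPoch q e₃ s / qPoch q (q * a / e₃) s) * (qPoch q e₄ s / qPoch q (q * a / e₄) s) *
      (qPoch q e₅ s / qPoch q (q * a / e₅) s) * (qPoch q e₆ s / qPoch q (q * a / e₆) s) *
      (qPoch q e₇ s / qPoch q (q * a / e₇) s)

/-- The field `F = ℚ(q,z,α,β,w)` of rational functions over `ℚ`. -/
noncomputable abbrev F12 : Type := FractionRing (MvPolynomial (Fin 5) ℚ)

section QPoch

variable {F : Type*} [Field F] {q : F}

@[simp] lemma qPoch_zero (q a : F) : qPoch q a 0 = 1 := by simp [qPoch]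

lemma qPoch_succ (q a : F) (n : ℕ) : qPoch q a (n + 1) = qPoch q a n * (1 - a * q ^ n) := by
  simp [qPoch, prod_range_succ]

lemma qPoch_add (q a : F) (m n : ℕ) :
    qPoch q a (m + n) = qPoch q a m * qPoch q (a * q ^ m) n := by
  simp [qPoch, prod_range_add, pow_add, mul_assoc]

lemma qPoch_mul_base (q a : F) (n : ℕ) :
    (1 - a) * qPoch q (a * q) n = qPoch q a n * (1 - a * q ^ n) := by
  have h := qPoch_add q a 1 n
  rw [add_comm 1 n, qPoch_succ, pow_one] at h
  simpa [qPoch] using h.symm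

lemma qPoch_ne_zero_iff {a : F} {n : ℕ} : qPoch q a n ≠ 0 ↔ ∀ k < n, 1 - a * q ^ k ≠ 0 := by
  simp [qPoch, prod_ne_zero_iff]

lemma qPoch_ne_zero_of_le {a : F} {m n : ℕ} (h : qPoch q a n ≠ 0) (hmn : m ≤ n) :
    qPoch q a m ≠ 0 :=
  qPoch_ne_zero_iff.2 fun k hk => qPoch_ne_zero_iff.1 h k (hk.trans_le hmn)

lemma qPoch_inv_pow_eq_zero (hq : q ≠ 0) {m n : ℕ} (h : m < n) : qPoch q (q ^ m)⁻¹ n = 0 :=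
  prod_eq_zero (mem_range.2 h) (by field_simp; simp)

/-- Reversal of the order of the factors, for a quotient of two shifted factorials. -/
lemma qPoch_reverse (hq : q ≠ 0) {x y : F} (hx : x ≠ 0) (hy : y ≠ 0) (m : ℕ) :
    qPoch q x m * qPoch q (q / (y * q ^ m)) m * y ^ m =
      qPoch q y m * qPoch q (q / (x * q ^ m)) m * x ^ m := by
  have key : ∀ x y : F, x ≠ 0 → y ≠ 0 → qPoch q x m * qPoch q (q / (y * q ^ m)) m * y ^ m =
      ∏ k ∈ range m, ((1 - x * q ^ k) * (y - (q ^ k)⁻¹)) := by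
    intro x y hx hy
    have : qPoch q (q / (y * q ^ m)) m = ∏ k ∈ range m, (1 - y⁻¹ * (q ^ k)⁻¹) := by
      rw [qPoch, ← prod_range_reflect]
      refine prod_congr rfl fun k hk => ?_
      obtain ⟨l, rfl⟩ := Nat.exists_eq_add_of_lt (mem_range.1 hk)
      rw [show k + l + 1 - 1 - k = l by omega]
      field_simp
      ring
    rw [this, mul_assoc, ← card_range m, ← prod_const, card_range, ← prod_mul_distrib, qPoch,
      ← prod_mul_distrib]
    refine prod_congr rfl fun k _ => ?_
    field_simp
  rw [key x y hx hy, key y x hy hx]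
  refine prod_congr rfl fun k _ => ?_
  field_simp
  ring

/-- `x` is not an integral power of `q`. -/
def NonResonant (q x : F) : Prop := ∀ k : ℤ, x * q ^ k ≠ 1

lemma NonResonant.mul_zpow {x : F} (h : NonResonant q x) (hq : q ≠ 0) (k : ℤ) :
    NonResonant q (x * q ^ k) := fun l => by
  rw [mul_assoc, ← zpow_add₀ hq]; exact h _

lemma NonResonant.of_eq_mul_zpow {x y : F} (h : NonResonant q x) (hq : q ≠ 0) (k : ℤ)
    (e : y = x * q ^ k) : NonResonant q y := e ▸ h.mul_zpow hq k

lemma NonResonant.inv {x : F} (h : NonResonant q x) : NonResonant q x⁻¹ :=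
  fun k hk => h (-k) <| by
    rw [zpow_neg, ← inv_inj, inv_one, mul_inv, inv_inv, hk]

lemma NonResonant.one_sub_ne_zero {x : F} (h : NonResonant q x) : 1 - x ≠ 0 :=
  sub_ne_zero.2 fun e => h 0 (by simp [← e])

lemma NonResonant.qPoch_ne_zero {x : F} (h : NonResonant q x) (n : ℕ) : qPoch q x n ≠ 0 :=
  qPoch_ne_zero_iff.2 fun k _ => sub_ne_zero.2 fun e => h k (by simp [← e])

lemma qPoch_self_ne_zero (hr : ∀ k : ℕ, 0 < k → q ^ k ≠ 1) (n : ℕ) : qPoch q q n ≠ 0 :=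
  qPoch_ne_zero_iff.2 fun k _ => sub_ne_zero.2 fun e =>
    hr (k + 1) k.succ_pos (by rw [pow_succ', ← e])

/-- The part `(1-aq^{2s})/(1-a) (a;q)_s q^s/(q;q)_s` of the summand of a very-well-poised series. -/
noncomputable def vwpFactor (q a : F) (s : ℕ) : F :=
  (1 - a * q ^ (2 * s)) / (1 - a) * qPoch q a s * q ^ s / qPoch q q s

/-- The quotient `(e;q)_s/(qa/e;q)_s` of well-poised shifted factorials. -/
noncomputable def wpRatio (q a e : F) (s : ℕ) : F := qPoch q e s / qPoch q (q * a / e) s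

/-- The polynomial form of `jackson_certificate`, in terms of the elementary symmetric functions
`s₁, s₂, p` of `b, c, d`. -/
lemma jackson_certificate_aux (a s₁ s₂ p x K : F) :
    (1 - a * K ^ 2) * K *
      ((p - s₂ * (a * x) + s₁ * (a * x) ^ 2 - (a * x) ^ 3) * (p - a ^ 2 * x * K) * (x - 1) *
          (a * x - p * K) +
        (p ^ 2 - p * s₁ * (a * x) + s₂ * (a * x) ^ 2 - (a * x) ^ 3) * (x - K) *
          (p - a ^ 2 * x) * (1 - a * x * K)) =
    (p - a ^ 2 * x ^ 2) * x *
      (a * (1 - a * K) * (1 - s₁ * K + s₂ * K ^ 2 - p * K ^ 3) * (p - a ^ 2 * x * K) * (x - K) -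
        (1 - K) * (p - s₂ * (a * K) + s₁ * (a * K) ^ 2 - (a * K) ^ 3) * (a * x - p * K) *
          (1 - a * x * K)) := by
  ring

/-- The identity behind the telescoping proof of Jackson's sum. -/
lemma jackson_certificate {a b c d x K : F} (ha : a ≠ 0) (hb : b ≠ 0) (hc : c ≠ 0) (hd : d ≠ 0)
    (hx : x ≠ 0) (hb' : 1 - a * x / b ≠ 0) (hc' : 1 - a * x / c ≠ 0) (hd' : 1 - a * x / d ≠ 0)
    (he : 1 - b * c * d / (a * x) ≠ 0) :
    (1 - a * K ^ 2) * K * ((1 - a ^ 2 * x / (b * c * d) * K) * (1 - a * x) *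
        (1 - x⁻¹) * (1 - b * c * d / (a * x) * K) -
      (1 - a * x) * (1 - a * x / (b * c)) * (1 - a * x / (b * d)) * (1 - a * x / (c * d)) /
        ((1 - a * x / b) * (1 - a * x / c) * (1 - a * x / d) * (1 - a * x / (b * c * d))) *
      ((1 - x⁻¹ * K) * (1 - b * c * d / (a * x)) * (1 - a ^ 2 * x / (b * c * d)) *
        (1 - a * x * K))) =
    (1 - a ^ 2 * x ^ 2 / (b * c * d)) * (1 - a * x) /
        ((1 - a * x / b) * (1 - a * x / c) * (1 - a * x / d)) *
      ((1 - a * K) * (1 - b * K) * (1 - c * K) * (1 - d * K) * (1 - a ^ 2 * x / (b * c * d) * K) *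
          (1 - x⁻¹ * K) -
        (1 - K) * (1 - a * K / b) * (1 - a * K / c) * (1 - a * K / d) *
          (1 - b * c * d / (a * x) * K) * (1 - a * x * K)) := by
  have hp : b * c * d - a * x ≠ 0 := by
    intro h
    apply he
    field_simp
    linear_combination -h
  have hb₁ : b - a * x ≠ 0 := by
    intro h
    apply hb'
    field_simp
    linear_combination h
  have hc₁ : c - a * x ≠ 0 := by
    intro h
    apply hc'
    field_simp
    linear_combination h
  have hd₁ : d - a * x ≠ 0 := by
    intro h
    apply hd'
    field_simp
    linear_combination h
  have hpol := jackson_certificate_aux a (b + c + d) (b * c + b * d + c * d) (b * c * d) x K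
  have hρ : (1 - a * x) * (1 - a * x / (b * c)) * (1 - a * x / (b * d)) * (1 - a * x / (c * d)) /
        ((1 - a * x / b) * (1 - a * x / c) * (1 - a * x / d) * (1 - a * x / (b * c * d))) =
      (1 - a * x) * ((b * c - a * x) * (b * d - a * x) * (c * d - a * x)) /
        ((b - a * x) * (c - a * x) * (d - a * x) * (b * c * d - a * x)) := by
    rw [one_sub_div hb, one_sub_div hc, one_sub_div hd, one_sub_div (by positivity),
      one_sub_div (by positivity), one_sub_div (by positivity), one_sub_div (by positivity)]
    field_simp
  have hC : (1 - a ^ 2 * x ^ 2 / (b * c * d)) * (1 - a * x) /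
        ((1 - a * x / b) * (1 - a * x / c) * (1 - a * x / d)) =
      (b * c * d - a ^ 2 * x ^ 2) * (1 - a * x) /
        ((b - a * x) * (c - a * x) * (d - a * x)) := by
    rw [one_sub_div hb, one_sub_div hc, one_sub_div hd, one_sub_div (by positivity)]
    field_simp
  rw [hρ, hC]
  have h₁ : (1 - a * K ^ 2) * K * ((1 - a ^ 2 * x / (b * c * d) * K) * (1 - a * x) *
        (1 - x⁻¹) * (1 - b * c * d / (a * x) * K) -
      (1 - a * x) * ((b * c - a * x) * (b * d - a * x) * (c * d - a * x)) /
        ((b - a * x) * (c - a * x) * (d - a * x) * (b * c * d - a * x)) *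
      ((1 - x⁻¹ * K) * (1 - b * c * d / (a * x)) * (1 - a ^ 2 * x / (b * c * d)) *
        (1 - a * x * K))) =
      (1 - a * x) / ((b * c * d) * a * x ^ 2 * ((b - a * x) * (c - a * x) * (d - a * x))) *
      ((1 - a * K ^ 2) * K *
      ((b - a * x) * (c - a * x) * (d - a * x) * (b * c * d - a ^ 2 * x * K) * (x - 1) *
          (a * x - b * c * d * K) +
        (b * c - a * x) * (b * d - a * x) * (c * d - a * x) * (x - K) *
          (b * c * d - a ^ 2 * x) * (1 - a * x * K))) := by
    generalize (b * c - a * x) * (b * d - a * x) * (c * d - a * x) = N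
    generalize hD : (b - a * x) * (c - a * x) * (d - a * x) = D
    have hD0 : D ≠ 0 := by rw [← hD]; positivity
    have hbcd : b * c * d ≠ 0 := by positivity
    clear hpol hρ hC hD
    generalize b * c * d = p at *
    rw [show 1 - p / (a * x) = -(p - a * x) / (a * x) by field_simp; ring]
    field_simp
    ring
  rw [h₁]
  generalize hD : (b - a * x) * (c - a * x) * (d - a * x) = D at *
  have hD0 : D ≠ 0 := by rw [← hD]; positivity
  rw [show (b * c * d - a ^ 2 * x ^ 2) * (1 - a * x) / D *
      ((1 - a * K) * (1 - b * K) * (1 - c * K) * (1 - d * K) * (1 - a ^ 2 * x / (b * c * d) * K) *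
          (1 - x⁻¹ * K) -
        (1 - K) * (1 - a * K / b) * (1 - a * K / c) * (1 - a * K / d) *
          (1 - b * c * d / (a * x) * K) * (1 - a * x * K)) =
      (1 - a * x) / ((b * c * d) * a * x ^ 2 * D) *
      ((b * c * d - a ^ 2 * x ^ 2) * x *
        (a * (1 - a * K) * ((1 - b * K) * (1 - c * K) * (1 - d * K)) *
          (b * c * d - a ^ 2 * x * K) * (x - K) -
        (1 - K) * ((b - a * K) * (c - a * K) * (d - a * K)) * (a * x - b * c * d * K) *
          (1 - a * x * K))) by
    rw [one_sub_div hb, one_sub_div hc, one_sub_div hd]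
    generalize b - a * K = B
    generalize c - a * K = C
    generalize d - a * K = E
    generalize 1 - b * K = B'
    generalize 1 - c * K = C'
    generalize 1 - d * K = E'
    field_simp]
  congr 1
  rw [← hD]
  linear_combination hpol

/-- The summand `(a,b,c,d;q)_s/(q,qa/b,qa/c,qa/d;q)_s`. -/
noncomputable def wpProd (q a b c d : F) (s : ℕ) : F :=
  qPoch q a s * qPoch q b s * qPoch q c s * qPoch q d s /
    (qPoch q q s * qPoch q (q * a / b) s * qPoch q (q * a / c) s * qPoch q (q * a / d) s)

lemma jackson_term_sub {a b c d x : F} (ha : a ≠ 0) (hb : b ≠ 0) (hc : c ≠ 0) (hd : d ≠ 0)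
    (hx : x ≠ 0) (hb' : 1 - a * x / b ≠ 0) (hc' : 1 - a * x / c ≠ 0) (hd' : 1 - a * x / d ≠ 0)
    (hx1 : 1 - x⁻¹ ≠ 0) (hax : NonResonant q (a * x))
    (hae : NonResonant q (b * c * d / (a * x))) (he : NonResonant q (a ^ 2 * x / (b * c * d)))
    (hq : q ≠ 0) (s : ℕ) :
    vwpFactor q a s * wpRatio q a b s * wpRatio q a c s * wpRatio q a d s *
        wpRatio q a (a ^ 2 * x / (b * c * d) * q) s * wpRatio q a x⁻¹ s -
      (1 - a * x) * (1 - a * x / (b * c)) * (1 - a * x / (b * d)) * (1 - a * x / (c * d)) /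
        ((1 - a * x / b) * (1 - a * x / c) * (1 - a * x / d) * (1 - a * x / (b * c * d))) *
      (vwpFactor q a s * wpRatio q a b s * wpRatio q a c s * wpRatio q a d s *
        wpRatio q a (a ^ 2 * x / (b * c * d)) s * wpRatio q a (x⁻¹ * q) s) =
    (1 - a ^ 2 * x ^ 2 / (b * c * d)) * (1 - a * x) /
        ((1 - a * x / b) * (1 - a * x / c) * (1 - a * x / d)) /
        ((1 - a) * (1 - a ^ 2 * x / (b * c * d)) * (1 - x⁻¹)) *
      (wpProd q a b c d s * qPoch q (a ^ 2 * x / (b * c * d)) s * qPoch q x⁻¹ s /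
        (qPoch q (b * c * d / (a * x)) s * qPoch q (a * x) s)) *
      (((1 - a * q ^ s) * (1 - b * q ^ s) * (1 - c * q ^ s) * (1 - d * q ^ s) *
          (1 - a ^ 2 * x / (b * c * d) * q ^ s) * (1 - x⁻¹ * q ^ s) -
        (1 - q ^ s) * (1 - a * q ^ s / b) * (1 - a * q ^ s / c) * (1 - a * q ^ s / d) *
          (1 - b * c * d / (a * x) * q ^ s) * (1 - a * x * q ^ s)) /
        ((1 - b * c * d / (a * x) * q ^ s) * (1 - a * x * q ^ s))) := by
  have cert := jackson_certificate (K := q ^ s) ha hb hc hd hx hb' hc' hd' hae.one_sub_ne_zero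
  have e₁ := qPoch_mul_base q (a ^ 2 * x / (b * c * d)) s
  have e₂ := qPoch_mul_base q x⁻¹ s
  have e₃ := qPoch_mul_base q (b * c * d / (a * x)) s
  have e₄ := qPoch_mul_base q (a * x) s
  have n₁ := he.one_sub_ne_zero
  have n₃ := hae.one_sub_ne_zero
  have n₄ := hax.one_sub_ne_zero
  have m₃ := hae.qPoch_ne_zero s
  have m₄ := hax.qPoch_ne_zero s
  have p₃ := hae.qPoch_ne_zero (s + 1)
  have p₄ := hax.qPoch_ne_zero (s + 1)
  rw [qPoch_succ] at p₃ p₄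
  replace p₃ := right_ne_zero_of_mul p₃
  replace p₄ := right_ne_zero_of_mul p₄
  have hM : vwpFactor q a s * wpRatio q a b s * wpRatio q a c s * wpRatio q a d s =
      wpProd q a b c d s * ((1 - a * (q ^ s) ^ 2) * q ^ s / (1 - a)) := by
    simp only [vwpFactor, wpRatio, wpProd]
    ring
  rw [hM]
  simp only [wpRatio]
  rw [show q * a / (a ^ 2 * x / (b * c * d) * q) = b * c * d / (a * x) by field_simp,
    show q * a / (a ^ 2 * x / (b * c * d)) = b * c * d / (a * x) * q by field_simp,
    show q * a / x⁻¹ = a * x * q by field_simp, show q * a / (x⁻¹ * q) = a * x by field_simp,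
    eq_div_of_mul_eq n₁ ((mul_comm _ _).trans e₁), eq_div_of_mul_eq hx1 ((mul_comm _ _).trans e₂),
    eq_div_of_mul_eq n₃ ((mul_comm _ _).trans e₃), eq_div_of_mul_eq n₄ ((mul_comm _ _).trans e₄)]
  clear hM e₁ e₂ e₃ e₄ hax hae he
  revert cert
  generalize q ^ s = K at *
  generalize (1 - a * x) * (1 - a * x / (b * c)) * (1 - a * x / (b * d)) * (1 - a * x / (c * d)) /
        ((1 - a * x / b) * (1 - a * x / c) * (1 - a * x / d) * (1 - a * x / (b * c * d))) = ρ
  generalize (1 - a ^ 2 * x ^ 2 / (b * c * d)) * (1 - a * x) /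
        ((1 - a * x / b) * (1 - a * x / c) * (1 - a * x / d)) = C
  generalize (1 - a * K) * (1 - b * K) * (1 - c * K) * (1 - d * K) *
          (1 - a ^ 2 * x / (b * c * d) * K) * (1 - x⁻¹ * K) -
        (1 - K) * (1 - a * K / b) * (1 - a * K / c) * (1 - a * K / d) *
          (1 - b * c * d / (a * x) * K) * (1 - a * x * K) = B
  intro cert
  rw [show ∀ y z : F, C / y * z * (B / ((1 - b * c * d / (a * x) * K) * (1 - a * x * K))) =
    (C * B) * (z / y / ((1 - b * c * d / (a * x) * K) * (1 - a * x * K))) by intros; ring, ← cert]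
  clear cert
  generalize qPoch q (b * c * d / (a * x)) s = y₁ at *
  generalize qPoch q (a * x) s = y₂ at *
  generalize 1 - b * c * d / (a * x) * K = y₃ at *
  generalize 1 - a * x * K = y₄ at *
  generalize 1 - b * c * d / (a * x) = y₅ at *
  generalize 1 - a * x = y₆ at *
  generalize 1 - x⁻¹ = y₇ at *
  generalize 1 - a ^ 2 * x / (b * c * d) * K = y₉ at *
  generalize 1 - a ^ 2 * x / (b * c * d) = y₈ at *
  generalize 1 - x⁻¹ * K = y₁₀ at *
  generalize wpProd q a b c d s = M at *
  field_simp

lemma wpProd_succ (q a b c d : F) (s : ℕ) :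
    wpProd q a b c d (s + 1) = wpProd q a b c d s *
      ((1 - a * q ^ s) * (1 - b * q ^ s) * (1 - c * q ^ s) * (1 - d * q ^ s) /
        ((1 - q ^ (s + 1)) * (1 - a * q ^ (s + 1) / b) * (1 - a * q ^ (s + 1) / c) *
          (1 - a * q ^ (s + 1) / d))) := by
  have shift : ∀ y : F, q * a / y * q ^ s = a * q ^ (s + 1) / y := fun y => by ring
  rw [wpProd, wpProd, div_mul_div_comm]
  simp only [qPoch_succ, shift, ← pow_succ']
  congr 1 <;> simp only [mul_comm, mul_left_comm, mul_assoc]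

lemma jackson_partial_sum (hq : q ≠ 0) (hr : ∀ k : ℕ, 0 < k → q ^ k ≠ 1) {a b c d x : F}
    (ha : a ≠ 0) (hb : b ≠ 0) (hc : c ≠ 0) (hd : d ≠ 0)
    (hx : x ≠ 0) (hb' : 1 - a * x / b ≠ 0) (hc' : 1 - a * x / c ≠ 0) (hd' : 1 - a * x / d ≠ 0)
    (hx1 : 1 - x⁻¹ ≠ 0) (hax : NonResonant q (a * x))
    (hae : NonResonant q (b * c * d / (a * x))) (he : NonResonant q (a ^ 2 * x / (b * c * d)))
    (m : ℕ) (hbm : qPoch q (q * a / b) m ≠ 0) (hcm : qPoch q (q * a / c) m ≠ 0)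
    (hdm : qPoch q (q * a / d) m ≠ 0) :
    ∑ s ∈ range (m + 1),
        (vwpFactor q a s * wpRatio q a b s * wpRatio q a c s * wpRatio q a d s *
        wpRatio q a (a ^ 2 * x / (b * c * d) * q) s * wpRatio q a x⁻¹ s -
      (1 - a * x) * (1 - a * x / (b * c)) * (1 - a * x / (b * d)) * (1 - a * x / (c * d)) /
        ((1 - a * x / b) * (1 - a * x / c) * (1 - a * x / d) * (1 - a * x / (b * c * d))) *
      (vwpFactor q a s * wpRatio q a b s * wpRatio q a c s * wpRatio q a d s *
        wpRatio q a (a ^ 2 * x / (b * c * d)) s * wpRatio q a (x⁻¹ * q) s)) =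
      (1 - a ^ 2 * x ^ 2 / (b * c * d)) * (1 - a * x) /
        ((1 - a * x / b) * (1 - a * x / c) * (1 - a * x / d)) /
        ((1 - a) * (1 - a ^ 2 * x / (b * c * d)) * (1 - x⁻¹)) *
      (wpProd q a b c d m * qPoch q (a ^ 2 * x / (b * c * d)) m * qPoch q x⁻¹ m /
        (qPoch q (b * c * d / (a * x)) m * qPoch q (a * x) m)) *
      ((1 - a * q ^ m) * (1 - b * q ^ m) * (1 - c * q ^ m) * (1 - d * q ^ m) *
          (1 - a ^ 2 * x / (b * c * d) * q ^ m) * (1 - x⁻¹ * q ^ m) /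
        ((1 - b * c * d / (a * x) * q ^ m) * (1 - a * x * q ^ m))) := by
  have term := jackson_term_sub ha hb hc hd hx hb' hc' hd' hx1 hax hae he hq
  generalize (1 - a ^ 2 * x ^ 2 / (b * c * d)) * (1 - a * x) /
    ((1 - a * x / b) * (1 - a * x / c) * (1 - a * x / d)) /
    ((1 - a) * (1 - a ^ 2 * x / (b * c * d)) * (1 - x⁻¹)) = C at *
  generalize
    (1 - a * x) * (1 - a * x / (b * c)) * (1 - a * x / (b * d)) * (1 - a * x / (c * d)) /
    ((1 - a * x / b) * (1 - a * x / c) * (1 - a * x / d) * (1 - a * x / (b * c * d))) = ρ at *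
  induction m with
  | zero => rw [sum_range_one, term]; simp
  | succ m ihm =>
    rw [sum_range_succ, ihm (qPoch_ne_zero_of_le hbm m.le_succ) (qPoch_ne_zero_of_le hcm m.le_succ)
      (qPoch_ne_zero_of_le hdm m.le_succ), term, sub_div, mul_sub (C * _), add_sub_left_comm,
      add_eq_left, sub_eq_zero]
    have shift : ∀ y : F, q * a / y * q ^ m = a * q ^ (m + 1) / y := fun y => by ring
    have hb₂ := qPoch_ne_zero_iff.1 hbm m (by omega)
    have hc₂ := qPoch_ne_zero_iff.1 hcm m (by omega)
    have hd₂ := qPoch_ne_zero_iff.1 hdm m (by omega)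
    have hq₂ := qPoch_ne_zero_iff.1 (qPoch_self_ne_zero hr (m + 1)) m (by omega)
    have e₂ := qPoch_ne_zero_iff.1 (hax.qPoch_ne_zero (m + 2)) (m + 1) (by omega)
    have e₄ := qPoch_ne_zero_iff.1 (hae.qPoch_ne_zero (m + 2)) (m + 1) (by omega)
    rw [shift] at hb₂ hc₂ hd₂
    rw [← pow_succ'] at hq₂
    rw [wpProd_succ]
    simp only [qPoch_succ]
    clear ihm term hax hae he
    generalize 1 - a * q ^ (m + 1) / b = y₁ at *
    generalize 1 - a * q ^ (m + 1) / c = y₂ at *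
    generalize 1 - a * q ^ (m + 1) / d = y₃ at *
    generalize 1 - q ^ (m + 1) = y₄ at *
    generalize 1 - a * x * q ^ (m + 1) = y₅ at *
    generalize 1 - b * c * d / (a * x) * q ^ (m + 1) = y₆ at *
    generalize 1 - a * x * q ^ m = y₇
    generalize 1 - b * c * d / (a * x) * q ^ m = y₈
    generalize 1 - a ^ 2 * x / (b * c * d) * q ^ m = z₁
    generalize 1 - x⁻¹ * q ^ m = z₂
    generalize qPoch q (a ^ 2 * x / (b * c * d)) m = z₃
    generalize qPoch q (b * c * d / (a * x)) m = z₅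
    generalize qPoch q (a * x) m = z₆
    generalize qPoch q x⁻¹ m = z₄
    generalize 1 - a * q ^ m = z₇
    generalize 1 - b * q ^ m = z₈
    generalize 1 - c * q ^ m = z₉
    generalize 1 - d * q ^ m = z₁₀
    have h₁ : y₄ * y₁ * y₂ * y₃ * y₆ * y₅ / (y₆ * y₅) = y₄ * y₁ * y₂ * y₃ := by field_simp
    have h₂ : z₇ * z₈ * z₉ * z₁₀ / (y₄ * y₁ * y₂ * y₃) * (y₄ * y₁ * y₂ * y₃) =
      z₇ * z₈ * z₉ * z₁₀ := div_mul_cancel₀ _ (by simp [*])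
    rw [h₁]
    linear_combination
      (-C * wpProd q a b c d m * z₁ * z₂ * z₃ * z₄ / (y₈ * y₇ * (z₅ * z₆))) * h₂

/-- Jackson's summation formula for a terminating balanced very-well-poised `₈φ₇` series. -/
theorem jackson_sum (hq : q ≠ 0) (hr : ∀ k : ℕ, 0 < k → q ^ k ≠ 1) {a b c d : F}
    (ha : a ≠ 0) (hb : b ≠ 0) (hc : c ≠ 0) (hd : d ≠ 0) (ha' : NonResonant q a)
    (he : NonResonant q (b * c * d / a ^ 2)) (he' : NonResonant q (b * c * d / a)) (n : ℕ)
    (hb' : qPoch q (q * a / b) n ≠ 0) (hc' : qPoch q (q * a / c) n ≠ 0)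
    (hd' : qPoch q (q * a / d) n ≠ 0) :
    ∑ s ∈ range (n + 1), vwpFactor q a s * wpRatio q a b s * wpRatio q a c s * wpRatio q a d s *
        wpRatio q a (a ^ 2 * q ^ (n + 1) / (b * c * d)) s * wpRatio q a (q ^ n)⁻¹ s =
      qPoch q (q * a) n * qPoch q (q * a / (b * c)) n * qPoch q (q * a / (b * d)) n *
          qPoch q (q * a / (c * d)) n /
        (qPoch q (q * a / b) n * qPoch q (q * a / c) n * qPoch q (q * a / d) n *
          qPoch q (q * a / (b * c * d)) n) := by
  induction n with
  | zero => simp [vwpFactor, wpRatio, div_self ha'.one_sub_ne_zero]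
  | succ n ih =>
    have ih := ih (qPoch_ne_zero_of_le hb' n.le_succ) (qPoch_ne_zero_of_le hc' n.le_succ)
      (qPoch_ne_zero_of_le hd' n.le_succ)
    set x := q ^ (n + 1) with hx
    have hx0 : x ≠ 0 := pow_ne_zero _ hq
    have hx1 : 1 - x⁻¹ ≠ 0 := sub_ne_zero.2 fun e => hr (n + 1) n.succ_pos (by simpa using e.symm)
    have shift : ∀ y : F, q * a / y * q ^ n = a * x / y := fun y => by rw [hx]; ring
    have hb₁ : 1 - a * x / b ≠ 0 := by
      rw [← shift]; exact qPoch_ne_zero_iff.1 hb' n n.lt_succ_self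
    have hc₁ : 1 - a * x / c ≠ 0 := by
      rw [← shift]; exact qPoch_ne_zero_iff.1 hc' n n.lt_succ_self
    have hd₁ : 1 - a * x / d ≠ 0 := by
      rw [← shift]; exact qPoch_ne_zero_iff.1 hd' n n.lt_succ_self
    have hax : NonResonant q (a * x) := ha'.of_eq_mul_zpow hq (n + 1 : ℕ) (by rw [zpow_natCast])
    have hae : NonResonant q (b * c * d / (a * x)) :=
      he'.of_eq_mul_zpow hq (-(n + 1 : ℕ)) (by rw [zpow_neg, zpow_natCast, ← hx]; field_simp)
    have hee : NonResonant q (a ^ 2 * x / (b * c * d)) :=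
      he.inv.of_eq_mul_zpow hq (n + 1 : ℕ) (by rw [zpow_natCast, ← hx]; field_simp)
    have total := jackson_partial_sum hq hr ha hb hc hd hx0 hb₁ hc₁ hd₁ hx1 hax hae hee (n + 1)
      hb' hc' hd'
    rw [← hx, inv_mul_cancel₀ hx0, sub_self, mul_zero, zero_div, mul_zero, sum_sub_distrib,
      ← mul_sum, sub_eq_zero] at total
    have hxq : x⁻¹ * q = (q ^ n)⁻¹ := by rw [hx, pow_succ]; field_simp
    have hz : wpRatio q a (q ^ n)⁻¹ (n + 1) = 0 := by
      rw [wpRatio, qPoch_inv_pow_eq_zero hq n.lt_succ_self, zero_div]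
    have shift₁ : q * a * q ^ n = a * x := by rw [hx]; ring
    have last : ∑ s ∈ range (n + 1 + 1), vwpFactor q a s * wpRatio q a b s * wpRatio q a c s *
        wpRatio q a d s * wpRatio q a (a ^ 2 * x / (b * c * d)) s * wpRatio q a (q ^ n)⁻¹ s =
      ∑ s ∈ range (n + 1), vwpFactor q a s * wpRatio q a b s * wpRatio q a c s *
        wpRatio q a d s * wpRatio q a (a ^ 2 * x / (b * c * d)) s * wpRatio q a (q ^ n)⁻¹ s := by
      rw [sum_range_succ, hz, mul_zero, add_zero]
    rw [hxq, last, ih] at total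
    rw [pow_succ q (n + 1), ← hx,
      show a ^ 2 * (x * q) / (b * c * d) = a ^ 2 * x / (b * c * d) * q by ring, total,
      div_mul_div_comm]
    simp only [qPoch_succ, shift, shift₁]
    congr 1 <;> ac_rfl

end QPoch

section Bailey

variable {F : Type*} [Field F] {q : F}

lemma wpRatio_add (q a e : F) (he : e ≠ 0) (hq : q ≠ 0) (j m : ℕ) :
    wpRatio q a e (j + m) = wpRatio q a e j * wpRatio q (a * q ^ (2 * j)) (e * q ^ j) m := by
  rw [wpRatio, wpRatio, wpRatio, qPoch_add, qPoch_add, div_mul_div_comm,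
    show q * (a * q ^ (2 * j)) / (e * q ^ j) = q * a / e * q ^ j by field_simp; ring]

/-- Expansion of `(b,c,d;q)_s/(qa/b,qa/c,qa/d;q)_s` as a very-well-poised series. -/
lemma wpRatio_mul_eq_sum (hq : q ≠ 0) (hr : ∀ k : ℕ, 0 < k → q ^ k ≠ 1) {a b c d l : F}
    (ha : a ≠ 0) (hb : b ≠ 0) (hc : c ≠ 0) (hd : d ≠ 0) (hl : l ≠ 0)
    (hbcd : l * (b * c * d) = q * a ^ 2) (ha' : NonResonant q a) (hl' : NonResonant q l)
    (hal : NonResonant q (a / l)) (s : ℕ) (hb' : qPoch q (q * a / b) s ≠ 0)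
    (hc' : qPoch q (q * a / c) s ≠ 0) (hd' : qPoch q (q * a / d) s ≠ 0) :
    wpRatio q a b s * wpRatio q a c s * wpRatio q a d s =
      qPoch q (a / l) s / qPoch q (q * l) s * ∑ j ∈ range (s + 1),
        vwpFactor q l j * wpRatio q l (l * b / a) j * wpRatio q l (l * c / a) j *
          wpRatio q l (l * d / a) j * wpRatio q l (a * q ^ s) j * wpRatio q l (q ^ s)⁻¹ j := by
  have hb₁ : q * l / (l * b / a) = q * a / b := by field_simp
  have hc₁ : q * l / (l * c / a) = q * a / c := by field_simp
  have hd₁ : q * l / (l * d / a) = q * a / d := by field_simp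
  have jackson := jackson_sum hq hr hl (b := l * b / a) (c := l * c / a) (d := l * d / a)
    (by positivity) (by positivity) (by positivity) hl'
    (ha'.inv.of_eq_mul_zpow hq 1 (by
      field_simp
      linear_combination hbcd))
    (hal.inv.of_eq_mul_zpow hq 1 (by
      field_simp
      linear_combination hbcd)) s
    (by rwa [hb₁]) (by rwa [hc₁]) (by rwa [hd₁])
  rw [hb₁, hc₁, hd₁,
    show l ^ 2 * q ^ (s + 1) / (l * b / a * (l * c / a) * (l * d / a)) = a * q ^ s by
      field_simp
      linear_combination -q ^ s * hbcd,
    show q * l / (l * b / a * (l * c / a)) = d by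
      field_simp
      linear_combination -hbcd,
    show q * l / (l * b / a * (l * d / a)) = c by
      field_simp
      linear_combination -hbcd,
    show q * l / (l * c / a * (l * d / a)) = b by
      field_simp
      linear_combination -hbcd,
    show q * l / (l * b / a * (l * c / a) * (l * d / a)) = a / l by
      field_simp
      linear_combination -hbcd] at jackson
  rw [jackson]
  have h₁ := hal.qPoch_ne_zero s
  have h₂ : qPoch q (q * l) s ≠ 0 := (hl'.of_eq_mul_zpow hq 1 (by simp [mul_comm])).qPoch_ne_zero s
  simp only [wpRatio]
  field_simp

/-- Recombination of the factors depending on the outer index `j + m`. -/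
lemma vwpFactor_add (hq : q ≠ 0) (hr : ∀ k : ℕ, 0 < k → q ^ k ≠ 1) {a l : F}
    (ha : a ≠ 0) (hl : l ≠ 0) (ha' : NonResonant q a) (hl' : NonResonant q l)
    (hal : NonResonant q (a / l)) (j m : ℕ) :
    vwpFactor q a (j + m) * (qPoch q (a / l) (j + m) / qPoch q (q * l) (j + m)) *
        wpRatio q l (a * q ^ (j + m)) j * wpRatio q l (q ^ (j + m))⁻¹ j =
      qPoch q (q * a) (2 * j) / qPoch q (q * l) (2 * j) * (a / l) ^ j *
        (vwpFactor q (a * q ^ (2 * j)) m * wpRatio q (a * q ^ (2 * j)) (a / l) m) := by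
  have r₁ := qPoch_reverse hq (x := a / l * q ^ m) (y := q * q ^ m) (by positivity)
    (by positivity) j
  have s₁ : q / (q * q ^ m * q ^ j) = (q ^ (j + m))⁻¹ := by field_simp; ring
  have s₂ : q / (a / l * q ^ m * q ^ j) = q * l / (a * q ^ (j + m)) := by field_simp; ring
  rw [s₁, s₂] at r₁
  have hA : qPoch q a (j + m) * qPoch q (a * q ^ (j + m)) j =
      qPoch q a (2 * j) * qPoch q (a * q ^ (2 * j)) m := by
    rw [← qPoch_add, ← qPoch_add]; congr 1; omega
  have hA' := qPoch_mul_base q a (2 * j)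
  have hL : qPoch q (q * l) (j + m) * qPoch q (q * l * q ^ (j + m)) j =
      qPoch q (q * l) (2 * j) * qPoch q (q * l * q ^ (2 * j)) m := by
    rw [← qPoch_add, ← qPoch_add]; congr 1; omega
  have hAL : qPoch q (a / l) (j + m) = qPoch q (a / l) m * qPoch q (a / l * q ^ m) j := by
    rw [← qPoch_add, add_comm]
  have hQ : qPoch q q (j + m) = qPoch q q m * qPoch q (q * q ^ m) j := by
    rw [← qPoch_add, add_comm]
  have t₁ : q * l / (q ^ (j + m))⁻¹ = q * l * q ^ (j + m) := by field_simp
  have t₂ : q * (a * q ^ (2 * j)) / (a / l) = q * l * q ^ (2 * j) := by field_simp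
  have hql : NonResonant q (q * l) := hl'.of_eq_mul_zpow hq 1 (by simp [mul_comm])
  have n₁ := hql.qPoch_ne_zero (j + m)
  have n₂ : qPoch q (q * l * q ^ (j + m)) j ≠ 0 :=
    (hql.of_eq_mul_zpow hq (j + m : ℕ) (by rw [zpow_natCast])).qPoch_ne_zero j
  have n₃ := hql.qPoch_ne_zero (2 * j)
  have n₄ : qPoch q (q * l * q ^ (2 * j)) m ≠ 0 :=
    (hql.of_eq_mul_zpow hq (2 * j : ℕ) (by rw [zpow_natCast])).qPoch_ne_zero m
  have n₅ := qPoch_self_ne_zero hr m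
  have n₆ := qPoch_self_ne_zero hr (j + m)
  rw [hQ] at n₆
  replace n₆ := right_ne_zero_of_mul n₆
  have n₇ : qPoch q (q * l / (a * q ^ (j + m))) j ≠ 0 :=
    (hal.inv.of_eq_mul_zpow hq (1 - (j + m : ℕ)) (by
      rw [zpow_sub₀ hq, zpow_natCast, zpow_one]; field_simp)).qPoch_ne_zero j
  have n₈ := ha'.one_sub_ne_zero
  have n₉ : 1 - a * q ^ (2 * j) ≠ 0 :=
    (ha'.of_eq_mul_zpow hq (2 * j : ℕ) (by rw [zpow_natCast])).one_sub_ne_zero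
  have hA'' : qPoch q (q * a) (2 * j) = qPoch q a (2 * j) * (1 - a * q ^ (2 * j)) / (1 - a) := by
    rw [mul_comm q a, ← hA']; field_simp
  simp only [vwpFactor, wpRatio]
  rw [t₁, t₂, hA'', hAL, hQ,
    show a * q ^ (2 * j) * q ^ (2 * m) = a * q ^ (2 * (j + m)) by ring]
  have e₁ : qPoch q a (j + m) * qPoch q (a * q ^ (j + m)) j /
      (qPoch q (q * l) (j + m) * qPoch q (q * l * q ^ (j + m)) j) =
      qPoch q a (2 * j) * qPoch q (a * q ^ (2 * j)) m /
        (qPoch q (q * l) (2 * j) * qPoch q (q * l * q ^ (2 * j)) m) := by rw [hA, hL]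
  have e₂ : qPoch q (a / l * q ^ m) j * qPoch q (q ^ (j + m))⁻¹ j /
      (qPoch q (q * q ^ m) j * qPoch q (q * l / (a * q ^ (j + m))) j) * q ^ j = (a / l) ^ j := by
    rw [mul_pow, mul_pow] at r₁
    generalize qPoch q (a / l * q ^ m) j = y₁ at *
    generalize qPoch q (q ^ (j + m))⁻¹ j = y₂ at *
    generalize qPoch q (q * q ^ m) j = y₃ at *
    generalize qPoch q (q * l / (a * q ^ (j + m))) j = y₄ at *
    rw [div_mul_eq_mul_div, div_eq_iff (by positivity)]
    have : (q ^ m) ^ j ≠ 0 := by positivity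
    apply mul_right_cancel₀ this
    linear_combination r₁
  have e₃ : (1 - a * q ^ (2 * j)) / (1 - a * q ^ (2 * j)) = 1 := div_self n₉
  rw [← e₂]
  clear r₁ s₁ s₂ hA hA' hL hAL hQ t₁ t₂ hA'' e₂ n₁ n₂ n₃ n₄ n₅ n₆ n₇ n₈ n₉
  generalize qPoch q (a / l * q ^ m) j = y₁ at *
  generalize qPoch q (q ^ (j + m))⁻¹ j = y₂ at *
  generalize qPoch q (q * q ^ m) j = y₃ at *
  generalize qPoch q (q * l / (a * q ^ (j + m))) j = y₄ at *
  generalize qPoch q (q * l * q ^ (j + m)) j = y₅ at *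
  generalize qPoch q (a * q ^ (j + m)) j = y₆ at *
  generalize 1 - a * q ^ (2 * (j + m)) = y₇ at *
  generalize 1 - a * q ^ (2 * j) = y₈ at *
  rw [pow_add q j m]
  linear_combination
    (y₇ / (1 - a) * q ^ j * q ^ m / qPoch q q m * qPoch q (a / l) m * (y₁ * y₂ / (y₃ * y₄))) * e₁ -
    (y₇ / (1 - a) * q ^ j * q ^ m / qPoch q q m * qPoch q (a / l) m * (y₁ * y₂ / (y₃ * y₄))) *
      (qPoch q a (2 * j) * qPoch q (a * q ^ (2 * j)) m /
        (qPoch q (q * l) (2 * j) * qPoch q (q * l * q ^ (2 * j)) m)) * e₃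

end Bailey

section Transformation

variable {F : Type*} [Field F] {q : F}

lemma wpRatio_mul_qPoch_div {a l e : F} {j p : ℕ} (hj : qPoch q (q * l / e) j ≠ 0) :
    wpRatio q a e j * (qPoch q (q * l / e * q ^ j) p / qPoch q (q * a / e * q ^ j) p) =
      qPoch q (q * l / e) (j + p) / qPoch q (q * a / e) (j + p) * wpRatio q l e j := by
  simp only [wpRatio, qPoch_add]
  field_simp

lemma bailey_coefficient (hq : q ≠ 0) {a l e f g : F} {j p : ℕ} (ha : a ≠ 0) (hl : l ≠ 0)
    (he : e ≠ 0) (hf : f ≠ 0) (hg : g ≠ 0) (hefg : e * f * g = l * a * q ^ (j + p + 1))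
    (ha' : NonResonant q a) (hag : NonResonant q (a / g))
    (hle : NonResonant q (l / e)) (hlf : NonResonant q (l / f)) (hlg : NonResonant q (l / g)) :
    qPoch q (q * a) (2 * j) / qPoch q (q * l) (2 * j) * (a / l) ^ j *
        (wpRatio q a e j * wpRatio q a f j * wpRatio q a g j * wpRatio q a (q ^ (j + p))⁻¹ j) *
        (qPoch q (q * a * q ^ (2 * j)) p * qPoch q (q * l / e * q ^ j) p *
            qPoch q (q * l / f * q ^ j) p * qPoch q (q * a / (e * f)) p /
          (qPoch q (q * l * q ^ (2 * j)) p * qPoch q (q * a / e * q ^ j) p *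
            qPoch q (q * a / f * q ^ j) p * qPoch q (q * l / (e * f)) p)) =
      qPoch q (q * a) (j + p) * qPoch q (q * a / (e * f)) (j + p) * qPoch q (q * l / e) (j + p) *
          qPoch q (q * l / f) (j + p) /
        (qPoch q (q * a / e) (j + p) * qPoch q (q * a / f) (j + p) *
          qPoch q (q * l / (e * f)) (j + p) * qPoch q (q * l) (j + p)) *
        (wpRatio q l e j * wpRatio q l f j * wpRatio q l g j * wpRatio q l (q ^ (j + p))⁻¹ j) := by
  have hqx : ∀ {x y : F}, NonResonant q (x / y) → NonResonant q (q * x / y) := fun h =>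
    h.of_eq_mul_zpow hq 1 (by rw [zpow_one]; ring)
  have E := wpRatio_mul_qPoch_div (a := a) (p := p) ((hqx hle).qPoch_ne_zero j)
  have E' := wpRatio_mul_qPoch_div (a := a) (p := p) ((hqx hlf).qPoch_ne_zero j)
  have split : ∀ x : F, qPoch q (q * x) (2 * j) * qPoch q (q * x * q ^ (2 * j)) p =
      qPoch q (q * x) (j + p) * qPoch q (q * x / (q ^ (j + p))⁻¹) j := fun x => by
    rw [div_inv_eq_mul, ← qPoch_add, ← qPoch_add]
    congr 1
    omega
  have hN : NonResonant q (q * a / (q ^ (j + p))⁻¹) :=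
    ha'.of_eq_mul_zpow hq (j + p + 1 : ℕ) (by rw [zpow_natCast]; field_simp; ring)
  have A := (div_eq_iff (hN.qPoch_ne_zero j)).2 (split a)
  have L := congrArg (·⁻¹) (split l)
  have G : wpRatio q a g j * (a / l) ^ j *
      (qPoch q (q * a / (e * f)) p / qPoch q (q * l / (e * f)) p) =
      qPoch q (q * a / (e * f)) (j + p) / qPoch q (q * l / (e * f)) (j + p) * wpRatio q l g j := by
    have rev := qPoch_reverse hq (x := q * l / g) (y := q * a / g) (by positivity)
      (by positivity) j
    have s₁ : q / (q * a / g * q ^ j) = q * l / (e * f) * q ^ p := by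
      field_simp
      linear_combination hefg
    have s₂ : q / (q * l / g * q ^ j) = q * a / (e * f) * q ^ p := by
      field_simp
      linear_combination hefg
    have n₁ := (hqx hag).qPoch_ne_zero j
    have n₂ := (hqx hlg).qPoch_ne_zero j
    have n₃ : qPoch q (q * l / (e * f) * q ^ p) j ≠ 0 := by
      rw [← s₁]
      refine (hag.inv.of_eq_mul_zpow hq (-(j : ℕ)) ?_).qPoch_ne_zero j
      rw [zpow_neg, zpow_natCast]
      field_simp
    rw [s₁, s₂] at rev
    simp only [wpRatio]
    rw [add_comm j p, qPoch_add, qPoch_add]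
    generalize qPoch q (q * l / g) j = y₁ at *
    generalize qPoch q (q * a / g) j = y₂ at *
    generalize qPoch q (q * l / (e * f) * q ^ p) j = y₃ at *
    generalize qPoch q (q * a / (e * f) * q ^ p) j = y₄ at *
    have key : (a / l) ^ j / y₂ = y₄ / y₃ / y₁ := by
      rw [mul_div_assoc, mul_div_assoc, mul_pow, mul_pow, div_pow, div_pow] at rev
      rw [div_pow]
      field_simp
      field_simp at rev
      linear_combination rev
    linear_combination
      qPoch q g j * (qPoch q (q * a / (e * f)) p / qPoch q (q * l / (e * f)) p) * key
  have key := congrArg₂ (· * ·) (congrArg₂ (· * ·) (congrArg₂ (· * ·) E E') G)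
    (congrArg₂ (· * ·) A L)
  simp only [wpRatio] at key ⊢
  linear_combination qPoch q (q ^ (j + p))⁻¹ j * key

/-- The inner sum in the proof of Bailey's transformation, evaluated by Jackson's sum. -/
lemma bailey_inner_sum (hq : q ≠ 0) (hr : ∀ k : ℕ, 0 < k → q ^ k ≠ 1) {a l e f g : F} {j p : ℕ}
    (ha : a ≠ 0) (hl : l ≠ 0) (he : e ≠ 0) (hf : f ≠ 0) (hg : g ≠ 0)
    (hefg : e * f * g = l * a * q ^ (j + p + 1)) (ha' : NonResonant q a) (hl' : NonResonant q l)
    (hg' : NonResonant q g) (hae : NonResonant q (a / e)) (haf : NonResonant q (a / f))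
    (hag : NonResonant q (a / g)) :
    ∑ m ∈ range (p + 1), vwpFactor q (a * q ^ (2 * j)) m * wpRatio q (a * q ^ (2 * j)) (a / l) m *
        wpRatio q (a * q ^ (2 * j)) (e * q ^ j) m * wpRatio q (a * q ^ (2 * j)) (f * q ^ j) m *
        wpRatio q (a * q ^ (2 * j)) (g * q ^ j) m * wpRatio q (a * q ^ (2 * j)) (q ^ p)⁻¹ m =
      qPoch q (q * a * q ^ (2 * j)) p * qPoch q (q * l / e * q ^ j) p *
          qPoch q (q * l / f * q ^ j) p * qPoch q (q * a / (e * f)) p /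
        (qPoch q (q * l * q ^ (2 * j)) p * qPoch q (q * a / e * q ^ j) p *
          qPoch q (q * a / f * q ^ j) p * qPoch q (q * l / (e * f)) p) := by
  have t₁ : q * (a * q ^ (2 * j)) / (a / l) = q * l * q ^ (2 * j) := by field_simp
  have t₂ : q * (a * q ^ (2 * j)) / (e * q ^ j) = q * a / e * q ^ j := by field_simp; ring
  have t₃ : q * (a * q ^ (2 * j)) / (f * q ^ j) = q * a / f * q ^ j := by field_simp; ring
  have hpow : ∀ k : ℕ, q * q ^ k = q ^ (k + 1 : ℤ) := fun k => by
    rw [zpow_add_one₀ hq, zpow_natCast, mul_comm]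
  have jackson := jackson_sum hq hr (a := a * q ^ (2 * j)) (b := a / l) (c := e * q ^ j)
    (d := f * q ^ j) (by positivity) (by positivity) (by positivity) (by positivity)
    (ha'.of_eq_mul_zpow hq (2 * j : ℕ) (by rw [zpow_natCast]))
    (hg'.inv.of_eq_mul_zpow hq (p + 1 - j : ℤ) (by
      rw [zpow_sub₀ hq, ← hpow, zpow_natCast]
      field_simp
      linear_combination q ^ (3 * j) * hefg))
    (hag.of_eq_mul_zpow hq (j + p + 1 : ℕ) (by
      rw [zpow_natCast]
      field_simp
      linear_combination q ^ (2 * j) * hefg)) p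
    (by
      rw [t₁]
      exact (hl'.of_eq_mul_zpow hq (2 * j + 1 : ℕ) (by rw [zpow_natCast]; ring)).qPoch_ne_zero p)
    (by
      rw [t₂]
      exact (hae.of_eq_mul_zpow hq (j + 1 : ℕ) (by rw [zpow_natCast]; ring)).qPoch_ne_zero p)
    (by
      rw [t₃]
      exact (haf.of_eq_mul_zpow hq (j + 1 : ℕ) (by rw [zpow_natCast]; ring)).qPoch_ne_zero p)
  rw [t₁, t₂, t₃, ← mul_assoc q a,
    show (a * q ^ (2 * j)) ^ 2 * q ^ (p + 1) / (a / l * (e * q ^ j) * (f * q ^ j)) = g * q ^ j by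
      field_simp
      linear_combination -q ^ (3 * j) * hefg,
    show q * a * q ^ (2 * j) / (a / l * (e * q ^ j)) = q * l / e * q ^ j by field_simp; ring,
    show q * a * q ^ (2 * j) / (a / l * (f * q ^ j)) = q * l / f * q ^ j by field_simp; ring,
    show q * a * q ^ (2 * j) / (e * q ^ j * (f * q ^ j)) = q * a / (e * f) by field_simp; ring,
    show q * a * q ^ (2 * j) / (a / l * (e * q ^ j) * (f * q ^ j)) = q * l / (e * f) by
      field_simp; ring] at jackson
  exact jackson

/-- Bailey's transformation formula for terminating balanced very-well-poised `₁₀φ₉` series. -/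
theorem bailey_transformation (hq : q ≠ 0) (hr : ∀ k : ℕ, 0 < k → q ^ k ≠ 1)
    {a b c d e f g l : F} {N : ℕ}
    (ha : a ≠ 0) (hb : b ≠ 0) (hc : c ≠ 0) (hd : d ≠ 0) (he : e ≠ 0) (hf : f ≠ 0) (hg : g ≠ 0)
    (hl : l ≠ 0) (hbcd : l * (b * c * d) = q * a ^ 2) (hefg : e * f * g = l * a * q ^ (N + 1))
    (ha' : NonResonant q a) (hl' : NonResonant q l) (hal : NonResonant q (a / l))
    (hg' : NonResonant q g) (hae : NonResonant q (a / e)) (haf : NonResonant q (a / f))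
    (hag : NonResonant q (a / g)) (hle : NonResonant q (l / e)) (hlf : NonResonant q (l / f))
    (hlg : NonResonant q (l / g)) (hb' : qPoch q (q * a / b) N ≠ 0)
    (hc' : qPoch q (q * a / c) N ≠ 0) (hd' : qPoch q (q * a / d) N ≠ 0) :
    ∑ s ∈ range (N + 1), vwpFactor q a s *
        (wpRatio q a b s * wpRatio q a c s * wpRatio q a d s) *
        (wpRatio q a e s * wpRatio q a f s * wpRatio q a g s * wpRatio q a (q ^ N)⁻¹ s) =
      qPoch q (q * a) N * qPoch q (q * a / (e * f)) N * qPoch q (q * l / e) N *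
          qPoch q (q * l / f) N /
        (qPoch q (q * a / e) N * qPoch q (q * a / f) N * qPoch q (q * l / (e * f)) N *
          qPoch q (q * l) N) *
      ∑ s ∈ range (N + 1), vwpFactor q l s *
        (wpRatio q l (l * b / a) s * wpRatio q l (l * c / a) s * wpRatio q l (l * d / a) s) *
        (wpRatio q l e s * wpRatio q l f s * wpRatio q l g s * wpRatio q l (q ^ N)⁻¹ s) := by
  let term (j m : ℕ) : F :=
    vwpFactor q a (j + m) * (wpRatio q a e (j + m) * wpRatio q a f (j + m) *
        wpRatio q a g (j + m) * wpRatio q a (q ^ N)⁻¹ (j + m)) *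
      (qPoch q (a / l) (j + m) / qPoch q (q * l) (j + m)) *
      (vwpFactor q l j * wpRatio q l (l * b / a) j * wpRatio q l (l * c / a) j *
        wpRatio q l (l * d / a) j * wpRatio q l (a * q ^ (j + m)) j *
        wpRatio q l (q ^ (j + m))⁻¹ j)
  calc
    _ = ∑ s ∈ range (N + 1), ∑ j ∈ range (s + 1), term j (s - j) := by
      refine sum_congr rfl fun s hs => ?_
      have hs : s ≤ N := Nat.lt_succ_iff.1 (mem_range.1 hs)
      rw [wpRatio_mul_eq_sum hq hr ha hb hc hd hl hbcd ha' hl' hal s (qPoch_ne_zero_of_le hb' hs)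
        (qPoch_ne_zero_of_le hc' hs) (qPoch_ne_zero_of_le hd' hs), mul_right_comm, ← mul_assoc,
        mul_sum]
      refine sum_congr rfl fun j hj => ?_
      simp only [term, Nat.add_sub_of_le (Nat.lt_succ_iff.1 (mem_range.1 hj))]
    _ = ∑ j ∈ range (N + 1), ∑ m ∈ range (N + 1 - j), term j m := sum_range_diag_flip _ _
    _ = _ := by
      rw [mul_sum]
      refine sum_congr rfl fun j hj => ?_
      obtain ⟨p, rfl⟩ := Nat.exists_eq_add_of_le (Nat.lt_succ_iff.1 (mem_range.1 hj))
      rw [show j + p + 1 - j = p + 1 by omega]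
      have coeff := bailey_coefficient hq ha hl he hf hg hefg ha' hag hle hlf hlg
      rw [← bailey_inner_sum hq hr ha hl he hf hg hefg ha' hl' hg' hae haf hag, mul_sum] at coeff
      rw [mul_left_comm, ← coeff, mul_sum]
      refine sum_congr rfl fun m _ => ?_
      have factor := vwpFactor_add hq hr ha hl ha' hl' hal j m
      have shift : (q ^ (j + p))⁻¹ * q ^ j = (q ^ p)⁻¹ := by rw [pow_add]; field_simp
      simp only [term]
      rw [wpRatio_add q a e he hq, wpRatio_add q a f hf hq, wpRatio_add q a g hg hq,
        wpRatio_add q a (q ^ (j + p))⁻¹ (by positivity) hq, shift]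
      generalize wpRatio q (a * q ^ (2 * j)) (e * q ^ j) m = y₁
      generalize wpRatio q (a * q ^ (2 * j)) (f * q ^ j) m = y₂
      generalize wpRatio q (a * q ^ (2 * j)) (g * q ^ j) m = y₃
      generalize wpRatio q (a * q ^ (2 * j)) (q ^ p)⁻¹ m = y₄
      linear_combination (wpRatio q a e j * wpRatio q a f j * wpRatio q a g j *
        wpRatio q a (q ^ (j + p))⁻¹ j * (y₁ * y₂ * y₃ * y₄) * vwpFactor q l j *
        wpRatio q l (l * b / a) j * wpRatio q l (l * c / a) j * wpRatio q l (l * d / a) j) * factor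

end Transformation

section Prefactor

variable {F : Type*} [Field F] {q : F}

lemma NonResonant.div_mul_pow {x : F} (h : NonResonant q x) (hq : q ≠ 0) (n : ℕ) :
    NonResonant q (q / (x * q ^ n)) :=
  h.inv.of_eq_mul_zpow hq (1 - n : ℤ) (by
    rw [zpow_sub₀ hq, zpow_natCast, zpow_one]
    ring)

/-- `qPoch_reverse` as an equality of quotients. -/
lemma qPoch_reverse_div (hq : q ≠ 0) {x y c : F} (hx : x ≠ 0) (hc : c ≠ 0) (h : y = c * x)
    (hy' : NonResonant q y) (m : ℕ) :
    qPoch q (q / (x * q ^ m)) m / qPoch q (q / (y * q ^ m)) m =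
      qPoch q x m / qPoch q y m * c ^ m := by
  have n₁ := hy'.qPoch_ne_zero m
  have n₂ := (hy'.div_mul_pow hq m).qPoch_ne_zero m
  subst h
  have rev := qPoch_reverse hq (mul_ne_zero hc hx) hx m
  rw [mul_pow c x m, ← mul_assoc] at rev
  replace rev := mul_right_cancel₀ (by positivity) rev
  rw [div_mul_eq_mul_div, div_eq_div_iff n₂ n₁]
  linear_combination rev

lemma qPoch_div_pow_swap (hq : q ≠ 0) {x : F} (hx : NonResonant q x) (i m : ℕ) :
    qPoch q (x / q ^ i) m / qPoch q (x / q ^ i) i =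
      qPoch q x m / qPoch q (x * q ^ m / q ^ i) i := by
  have h₁ := qPoch_add q (x / q ^ i) i m
  have h₂ := qPoch_add q (x / q ^ i) m i
  rw [div_mul_cancel₀ x (by positivity)] at h₁
  rw [add_comm m i, h₁, div_mul_eq_mul_div] at h₂
  have hxi : NonResonant q (x / q ^ i) :=
    hx.of_eq_mul_zpow hq (-i) (by rw [zpow_neg, zpow_natCast, div_eq_mul_inv])
  have hxm : NonResonant q (x * q ^ m / q ^ i) :=
    hxi.of_eq_mul_zpow hq m (by rw [zpow_natCast, div_mul_eq_mul_div])
  rw [div_eq_div_iff (hxi.qPoch_ne_zero i) (hxm.qPoch_ne_zero i), ← h₂, mul_comm]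

/-- Transformation of a quotient of shifted factorials of length `m` into length `j + m`. -/
lemma qPoch_div_extend (hq : q ≠ 0) {x y c : F} (hx : x ≠ 0) (hc : c ≠ 0) (h : y = c * x)
    (hx' : NonResonant q x) (hy' : NonResonant q y) (j m : ℕ) :
    qPoch q x m / qPoch q y m = qPoch q x (j + m) * qPoch q (q / (y * q ^ (j + m))) j /
      (qPoch q y (j + m) * qPoch q (q / (x * q ^ (j + m))) j) * c ^ j := by
  have hym : NonResonant q (y * q ^ m) := hy'.of_eq_mul_zpow hq m (by rw [zpow_natCast])
  have rev := qPoch_reverse_div hq (x := x * q ^ m) (y := y * q ^ m) (by positivity) hc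
    (by rw [h]; ring) hym j
  rw [mul_assoc x, mul_assoc y, ← pow_add, add_comm m j,
    div_mul_eq_mul_div,
    div_eq_div_iff ((hy'.div_mul_pow hq (j + m)).qPoch_ne_zero j) (hym.qPoch_ne_zero j)] at rev
  have n₁ := (hx'.div_mul_pow hq (j + m)).qPoch_ne_zero j
  have n₂ := hy'.qPoch_ne_zero (j + m)
  have n₃ := hy'.qPoch_ne_zero m
  rw [div_mul_eq_mul_div, div_eq_div_iff n₃ (mul_ne_zero n₂ n₁), add_comm j m, qPoch_add, qPoch_add]
  rw [add_comm j m] at rev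
  linear_combination qPoch q x m * qPoch q y m * rev

/-- Transformation of a quotient of reversed shifted factorials of length `m` into length
`j + m`. -/
lemma qPoch_reverse_div_extend (hq : q ≠ 0) {x y c : F} (hx : x ≠ 0) (hc : c ≠ 0)
    (h : y = c * x) (hx' : NonResonant q x) (hy' : NonResonant q y) (j m : ℕ) :
    qPoch q (q / (x * q ^ (j + m))) m / qPoch q (q / (y * q ^ (j + m))) m =
      qPoch q x (j + m) * qPoch q y j / (qPoch q y (j + m) * qPoch q x j) * c ^ m := by
  have hyj : NonResonant q (y * q ^ j) := hy'.of_eq_mul_zpow hq j (by rw [zpow_natCast])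
  have rev := qPoch_reverse_div hq (x := x * q ^ j) (y := y * q ^ j) (by positivity) hc
    (by rw [h]; ring) hyj m
  rw [mul_assoc x, mul_assoc y, ← pow_add] at rev
  rw [rev, qPoch_add, qPoch_add]
  have n₁ := hx'.qPoch_ne_zero j
  have n₂ := hy'.qPoch_ne_zero j
  field_simp

lemma qPoch_swap_div (hq : q ≠ 0) {x y c : F} (hx : x ≠ 0) (hc : c ≠ 0) (h : y = c * x)
    (hx' : NonResonant q x) (hy' : NonResonant q y) (i j m : ℕ) :
    qPoch q (y * q ^ j / q ^ i) m / qPoch q (y * q ^ j / q ^ i) i *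
        (qPoch q (x * q ^ j / q ^ i) i / qPoch q (x * q ^ j / q ^ i) m) * c ^ i =
      qPoch q y (j + m) * qPoch q x j * qPoch q (q / (x * q ^ (j + m))) i /
        (qPoch q x (j + m) * qPoch q y j * qPoch q (q / (y * q ^ (j + m))) i) := by
  have hj : ∀ {z : F}, NonResonant q z → NonResonant q (z * q ^ j) := fun hz =>
    hz.of_eq_mul_zpow hq j (by rw [zpow_natCast])
  have hn : NonResonant q (y * q ^ (j + m) / q ^ i) :=
    hy'.of_eq_mul_zpow hq ((j + m : ℕ) - i : ℤ) (by
      rw [zpow_sub₀ hq, zpow_natCast, zpow_natCast, mul_div_assoc])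
  have X := congrArg (·⁻¹) (qPoch_div_pow_swap hq (hj hx') i m)
  simp only [inv_div] at X
  have rev := qPoch_reverse_div hq (x := x * q ^ (j + m) / q ^ i) (y := y * q ^ (j + m) / q ^ i)
    (by positivity) hc (by rw [h]; ring) hn i
  rw [div_mul_cancel₀ _ (by positivity), div_mul_cancel₀ _ (by positivity)] at rev
  have n₁ := hx'.qPoch_ne_zero j
  have n₂ := hy'.qPoch_ne_zero j
  rw [X, qPoch_div_pow_swap hq (hj hy'), mul_assoc x, mul_assoc y, ← pow_add, qPoch_add q x j m,
    qPoch_add q y j m]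
  calc
    _ = qPoch q (y * q ^ j) m / qPoch q (x * q ^ j) m *
        (qPoch q (x * q ^ (j + m) / q ^ i) i / qPoch q (y * q ^ (j + m) / q ^ i) i * c ^ i) := by
      ring
    _ = _ := by
      rw [← rev]
      field_simp

lemma qPoch_reverse_swap_div (hq : q ≠ 0) {x y c : F} (hx : x ≠ 0) (hc : c ≠ 0) (h : y = c * x)
    (hx' : NonResonant q x) (hy' : NonResonant q y) (i j m : ℕ) :
    qPoch q (q / (y * q ^ m) / q ^ i) m / qPoch q (q / (y * q ^ m) / q ^ i) i *
        (qPoch q (q / (x * q ^ m) / q ^ i) i / qPoch q (q / (x * q ^ m) / q ^ i) m) *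
        c ^ (j + m) =
      qPoch q y (j + m) * qPoch q x i * qPoch q (q / (x * q ^ (j + m))) j /
        (qPoch q x (j + m) * qPoch q y i * qPoch q (q / (y * q ^ (j + m))) j) * c ^ i := by
  have hswap : ∀ {z : F}, z ≠ 0 → NonResonant q z →
      qPoch q (q / (z * q ^ m) / q ^ i) m / qPoch q (q / (z * q ^ m) / q ^ i) i =
      qPoch q (q / (z * q ^ m)) m / qPoch q (q / (z * q ^ i)) i := fun hz hz' => by
    rw [qPoch_div_pow_swap hq (hz'.div_mul_pow hq m)]
    congr 2
    field_simp
  have hy : y ≠ 0 := h ▸ mul_ne_zero hc hx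
  have X := congrArg (·⁻¹) (hswap hx hx')
  simp only [inv_div] at X
  have revm := qPoch_reverse_div hq (x := y) (c := c⁻¹) hy (inv_ne_zero hc)
    (by rw [h]; field_simp) hx' m
  have revi := qPoch_reverse_div hq hx hc h hy' i
  have ext := qPoch_div_extend hq hy (inv_ne_zero hc) (by rw [h]; field_simp) hy' hx' j m
  rw [ext] at revm
  rw [X, hswap hy hy', div_mul_div_comm, mul_comm (qPoch q (q / (y * q ^ i)) i), ← div_mul_div_comm,
    revm, revi]
  simp only [inv_pow, pow_add]
  field_simp

lemma bailey_prefactor_mul (hq : q ≠ 0) {k o p s t u v y c : F} (hc : c ≠ 0) (ho : o ≠ 0)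
    (hp : p ≠ 0) (hu : u ≠ 0) (hy : y ≠ 0) (hs : s = c * o) (ht : t = c * p) (hv : v = c * u)
    (hk : k = c * y) (hk' : NonResonant q k) (ho' : NonResonant q o) (hp' : NonResonant q p)
    (hs' : NonResonant q s) (ht' : NonResonant q t) (hu' : NonResonant q u)
    (hv' : NonResonant q v) (hy' : NonResonant q y) (i j m : ℕ) :
    qPoch q (q / (s * q ^ (j + m))) i * qPoch q t i * qPoch q (q / (y * q ^ m) / q ^ i) i *
          qPoch q (u * q ^ j / q ^ i) i /
        (qPoch q (q / (o * q ^ (j + m))) i * qPoch q p i * qPoch q (v * q ^ j / q ^ i) i *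
          qPoch q (q / (k * q ^ m) / q ^ i) i) *
      (qPoch q (q / (k * q ^ m) / q ^ i) m * qPoch q (v * q ^ j / q ^ i) m *
          qPoch q (q / (p * q ^ (j + m))) m * qPoch q o m /
        (qPoch q (q / (y * q ^ m) / q ^ i) m * qPoch q (u * q ^ j / q ^ i) m * qPoch q s m *
          qPoch q (q / (t * q ^ (j + m))) m)) =
      qPoch q p (j + m) * qPoch q o (j + m) * qPoch q k (j + m) * qPoch q v (j + m) /
          (qPoch q s (j + m) * qPoch q t (j + m) * qPoch q u (j + m) * qPoch q y (j + m)) *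
        (qPoch q t i * qPoch q y i * qPoch q (q / (s * q ^ (j + m))) i *
            qPoch q (q / (u * q ^ (j + m))) i /
          (qPoch q p i * qPoch q k i * qPoch q (q / (o * q ^ (j + m))) i *
            qPoch q (q / (v * q ^ (j + m))) i)) *
        (qPoch q t j * qPoch q u j * qPoch q (q / (s * q ^ (j + m))) j *
            qPoch q (q / (y * q ^ (j + m))) j /
          (qPoch q p j * qPoch q v j * qPoch q (q / (o * q ^ (j + m))) j *
            qPoch q (q / (k * q ^ (j + m))) j)) := by
  have key := congrArg₂ (· * ·)
    (congrArg₂ (· * ·) (qPoch_reverse_swap_div hq hy hc hk hy' hk' i j m)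
      (qPoch_swap_div hq hu hc hv hu' hv' i j m))
    (congrArg₂ (· * ·) (qPoch_div_extend hq ho hc hs ho' hs' j m)
      (qPoch_reverse_div_extend hq hp hc ht hp' ht' j m))
  have hpow : c ^ (j + m) * c ^ i ≠ 0 := by positivity
  apply mul_right_cancel₀ hpow
  rw [pow_add c j m] at key ⊢
  generalize qPoch q (q / (y * q ^ m) / q ^ i) i = x₁ at *
  generalize qPoch q (u * q ^ j / q ^ i) i = x₂ at *
  generalize qPoch q (v * q ^ j / q ^ i) i = x₃ at *
  generalize qPoch q (q / (k * q ^ m) / q ^ i) i = x₄ at *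
  generalize qPoch q (q / (y * q ^ m) / q ^ i) m = x₅ at *
  generalize qPoch q (u * q ^ j / q ^ i) m = x₆ at *
  generalize qPoch q (v * q ^ j / q ^ i) m = x₇ at *
  generalize qPoch q (q / (k * q ^ m) / q ^ i) m = x₈ at *
  linear_combination (qPoch q (q / (s * q ^ (j + m))) i * qPoch q t i /
    (qPoch q (q / (o * q ^ (j + m))) i * qPoch q p i)) * key

end Prefactor

section DoubleBailey

variable {F : Type*} [Field F] {q : F}

lemma NonResonant.of_mul_pow_eq {x y : F} (h : NonResonant q x) (hq : q ≠ 0) (k l : ℕ)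
    (e : y * q ^ k = x * q ^ l) : NonResonant q y :=
  h.of_eq_mul_zpow hq (l - k) <| by
    rw [zpow_sub₀ hq, zpow_natCast, zpow_natCast, ← mul_div_assoc, ← e]; field_simp

lemma qPoch_inv_pow_ne_zero (hq : q ≠ 0) (hr : ∀ k : ℕ, 0 < k → q ^ k ≠ 1) {m n : ℕ}
    (h : n ≤ m) : qPoch q (q ^ m)⁻¹ n ≠ 0 := by
  refine qPoch_ne_zero_iff.2 fun k hk => sub_ne_zero.2 fun e => hr (m - k) (by omega) ?_
  rw [pow_sub₀ q hq (by omega), ← inv_inj, mul_inv, inv_inv, ← e, inv_one]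

lemma vwpW_swap (a e₁ e₂ e₃ e₄ e₅ e₆ e₇ : F) (S : ℕ) :
    vwpW q a e₁ e₂ e₃ e₄ e₅ e₆ e₇ S = vwpW q a e₂ e₁ e₄ e₃ e₅ e₆ e₇ S :=
  sum_congr rfl fun _ _ => by ring

lemma vwpW_min (hq : q ≠ 0) (a e₃ e₄ e₅ e₆ e₇ : F) (i j : ℕ) :
    vwpW q a (q ^ i)⁻¹ (q ^ j)⁻¹ e₃ e₄ e₅ e₆ e₇ (min i j) =
      vwpW q a (q ^ i)⁻¹ (q ^ j)⁻¹ e₃ e₄ e₅ e₆ e₇ i := by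
  refine sum_subset (range_mono (by omega)) fun s hs hs' => ?_
  have : j < s := by simp at hs hs'; omega
  simp [qPoch_inv_pow_eq_zero hq this]

/-- Bailey's transformation formula for `vwpW` with two terminating parameters. -/
lemma vwpW_bailey (hq : q ≠ 0) (hr : ∀ k : ℕ, 0 < k → q ^ k ≠ 1) {a e f g l : F} {i j m : ℕ}
    (hi : i ≤ j + m) (ha : a ≠ 0) (he : e ≠ 0) (hf : f ≠ 0) (hg : g ≠ 0) (hl : l ≠ 0)
    (hefg : e * f * g = l * a * q ^ (i + 1))
    (ha' : NonResonant q a) (hl' : NonResonant q l) (hal : NonResonant q (a / l))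
    (hg' : NonResonant q g) (hae : NonResonant q (a / e)) (haf : NonResonant q (a / f))
    (hag : NonResonant q (a / g)) (hle : NonResonant q (l / e)) (hlf : NonResonant q (l / f))
    (hlg : NonResonant q (l / g)) :
    vwpW q a (q ^ i)⁻¹ (q ^ j)⁻¹ (a / (l * q ^ m)) g e (q * a * q ^ (j + m)) f (min i j) =
      qPoch q (q * a) i * qPoch q (q * a / (e * f)) i * qPoch q (q * l / e) i *
          qPoch q (q * l / f) i /
        (qPoch q (q * a / e) i * qPoch q (q * a / f) i * qPoch q (q * l / (e * f)) i *
          qPoch q (q * l) i) *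
      vwpW q l (q ^ i)⁻¹ (q ^ m)⁻¹ (l / (a * q ^ j)) g e (q * l * q ^ (j + m)) f (min i m) := by
  have bailey := bailey_transformation hq hr (b := (q ^ j)⁻¹) (c := a / (l * q ^ m))
    (d := q * a * q ^ (j + m)) ha (by positivity) (by positivity) (by positivity) he hf hg hl
    (by field_simp; ring) hefg ha' hl' hal hg' hae haf hag hle hlf hlg
    ((ha'.of_eq_mul_zpow hq (j + 1 : ℕ) (by
      rw [zpow_natCast]; field_simp; ring)).qPoch_ne_zero i)
    ((hl'.of_eq_mul_zpow hq (m + 1 : ℕ) (by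
      rw [zpow_natCast]; field_simp; ring)).qPoch_ne_zero i)
    (by
      rw [show q * a / (q * a * q ^ (j + m)) = (q ^ (j + m))⁻¹ by field_simp]
      exact qPoch_inv_pow_ne_zero hq hr hi)
  rw [show l * (q ^ j)⁻¹ / a = l / (a * q ^ j) by field_simp,
    show l * (a / (l * q ^ m)) / a = (q ^ m)⁻¹ by field_simp,
    show l * (q * a * q ^ (j + m)) / a = q * l * q ^ (j + m) by field_simp] at bailey
  rw [vwpW_min hq, vwpW_min hq]
  convert bailey using 2
  · exact sum_congr rfl fun _ _ => by simp only [vwpFactor, wpRatio]; ring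
  · exact sum_congr rfl fun _ _ => by simp only [vwpFactor, wpRatio]; ring

/-- The twofold application of Bailey's transformation, over an arbitrary field. -/
theorem vwpW_double_bailey (hq : q ≠ 0) (hr : ∀ k : ℕ, 0 < k → q ^ k ≠ 1) {z α β w : F}
    (hz : z ≠ 0) (hα : α ≠ 0) (hβ : β ≠ 0) (hw : w ≠ 0) (nα : NonResonant q α)
    (nβ : NonResonant q β) (nw : NonResonant q w) (nzα : NonResonant q (z / α))
    (nzβ : NonResonant q (z / β)) (nzw : NonResonant q (z / w)) (nwα : NonResonant q (w / α))
    (nwβ : NonResonant q (w / β)) (nwαβ : NonResonant q (w / (α * β)))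
    (nzwαβ : NonResonant q (z * w / (α * β))) {n i j : ℕ} (hi : i ≤ n) (hj : j ≤ n) :
    vwpW q (q ^ (-(n : ℤ)) * z / α)
        (q ^ (-(i : ℤ))) (q ^ (-(j : ℤ)))
        (q ^ ((i : ℤ) - (n : ℤ)) * w / α) (q ^ ((j : ℤ) - (n : ℤ)) * β / w)
        (z / (α * β)) (q * z / α) (q ^ (1 - (n : ℤ)) * z)
        (min i j) =
      ((qPoch q (1 / α) n * qPoch q (1 / β) n * qPoch q (w / z) n *
            qPoch q (α * β / (z * w)) n /
          (qPoch q (α / z) n * qPoch q (β / z) n * qPoch q (1 / w) n *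
            qPoch q (w / (α * β)) n)) *
        (qPoch q (β / z) i * qPoch q (w / (α * β)) i * qPoch q (q ^ (1 - (n : ℤ)) * z / α) i *
            qPoch q (q ^ (1 - (n : ℤ)) * w) i /
          (qPoch q (1 / α) i * qPoch q (w / z) i * qPoch q (q ^ (1 - (n : ℤ)) * β) i *
            qPoch q (q ^ (1 - (n : ℤ)) * z * w / (α * β)) i)) *
        (qPoch q (β / z) j * qPoch q (1 / w) j * qPoch q (q ^ (1 - (n : ℤ)) * z / α) j *
            qPoch q (q ^ (1 - (n : ℤ)) * α * β / w) j /
          (qPoch q (1 / α) j * qPoch q (α * β / (z * w)) j * qPoch q (q ^ (1 - (n : ℤ)) * β) j *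
            qPoch q (q ^ (1 - (n : ℤ)) * z / w) j))) *
      vwpW q (q ^ (-(n : ℤ)) * z / β)
        (q ^ ((i : ℤ) - (n : ℤ))) (q ^ ((j : ℤ) - (n : ℤ)))
        (q ^ (-(i : ℤ)) * α / w) (q ^ (-(j : ℤ)) * w / β)
        (z / (α * β)) (q * z / β) (q ^ (1 - (n : ℤ)) * z)
        (min (n - i) (n - j)) := by
  obtain ⟨m, rfl⟩ := Nat.exists_eq_add_of_le hj
  obtain ⟨i', hi'⟩ := Nat.exists_eq_add_of_le hi
  have hpow : q ^ (j + m) = q ^ i * q ^ i' := by rw [hi', pow_add]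
  have first := vwpW_bailey hq hr (a := (q ^ (j + m))⁻¹ * z / α) (e := z / (α * β))
    (f := q / q ^ (j + m) * z) (g := (q ^ m)⁻¹ * β / w) (l := z / (w * q ^ m) / q ^ i)
    (i := i) (j := j) (m := m) hi (by positivity) (by positivity) (by positivity) (by positivity)
    (by positivity) (by simp only [pow_add]; field_simp)
    (nzα.of_mul_pow_eq hq (j + m) 0 (by simp only [pow_add]; field_simp))
    (nzw.of_mul_pow_eq hq (m + i) 0 (by simp only [pow_add]; field_simp))
    (nwα.of_mul_pow_eq hq j i (by simp only [pow_add]; field_simp))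
    (nwβ.inv.of_mul_pow_eq hq m 0 (by field_simp))
    (nβ.of_mul_pow_eq hq (j + m) 0 (by simp only [pow_add]; field_simp))
    (nα.inv.of_mul_pow_eq hq 1 0 (by simp only [pow_add]; field_simp))
    (nzwαβ.of_mul_pow_eq hq j 0 (by simp only [pow_add]; field_simp))
    (nwαβ.inv.of_mul_pow_eq hq (m + i) 0 (by simp only [pow_add]; field_simp))
    (nw.inv.of_mul_pow_eq hq (i + 1) j (by simp only [pow_add]; field_simp))
    (nzβ.of_mul_pow_eq hq i 0 (by field_simp))
  have second := vwpW_bailey hq hr (a := z / (w * q ^ m) / q ^ i) (e := z / (α * β))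
    (f := q / q ^ (j + m) * z) (g := (q ^ i)⁻¹ * α / w) (l := (q ^ (j + m))⁻¹ * z / β)
    (i := m) (j := i) (m := i') (by omega) (by positivity) (by positivity) (by positivity)
    (by positivity) (by positivity) (by simp only [pow_add]; field_simp)
    (nzw.of_mul_pow_eq hq (m + i) 0 (by simp only [pow_add]; field_simp))
    (nzβ.of_mul_pow_eq hq (j + m) 0 (by simp only [pow_add]; field_simp))
    (nwβ.inv.of_mul_pow_eq hq i j (by simp only [pow_add]; field_simp))
    (nwα.inv.of_mul_pow_eq hq i 0 (by field_simp))
    (nwαβ.inv.of_mul_pow_eq hq (m + i) 0 (by simp only [pow_add]; field_simp))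
    (nw.inv.of_mul_pow_eq hq (i + 1) j (by simp only [pow_add]; field_simp))
    (nzα.of_mul_pow_eq hq m 0 (by field_simp))
    (nα.of_mul_pow_eq hq (j + m) 0 (by simp only [pow_add]; field_simp))
    (nβ.inv.of_mul_pow_eq hq 1 0 (by simp only [pow_add]; field_simp))
    (nzwαβ.of_mul_pow_eq hq (j + m) i (by simp only [pow_add]; field_simp))
  have prefactor := bailey_prefactor_mul hq (k := w / z) (o := 1 / β) (p := 1 / α) (s := α / z)
    (t := β / z) (u := 1 / w) (v := α * β / (z * w)) (y := w / (α * β)) (c := α * β / z)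
    (by positivity) (one_div_ne_zero hβ) (one_div_ne_zero hα) (one_div_ne_zero hw) (by positivity)
    (by field_simp) (by field_simp) (by field_simp) (by field_simp)
    (by simpa using nzw.inv) (by simpa using nβ.inv) (by simpa using nα.inv)
    (by simpa using nzα.inv) (by simpa using nzβ.inv) (by simpa using nw.inv)
    (by simpa using nzwαβ.inv) nwαβ i j m
  rw [← hi'] at second
  have hm_div : q ^ j / q ^ (j + m) = (q ^ m)⁻¹ := by rw [pow_add]; field_simp
  have hi_div : q ^ i / q ^ (j + m) = (q ^ i')⁻¹ := by rw [hpow]; field_simp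
  have ha₁ : q * ((q ^ (j + m))⁻¹ * z / α) = q / (α / z * q ^ (j + m)) := by field_simp
  have ha₂ : q * ((q ^ (j + m))⁻¹ * z / β) = q / (β / z * q ^ (j + m)) := by field_simp
  have hl : q * (z / (w * q ^ m) / q ^ i) = q / (w / z * q ^ m) / q ^ i := by field_simp
  have hn : j + m - i = i' := by omega
  have e₁ : (q ^ (j + m))⁻¹ * z / α / (z / (w * q ^ m) / q ^ i * q ^ m) = (q ^ i')⁻¹ * w / α := by
    rw [hpow]; field_simp
  have e₂ : z / (w * q ^ m) / q ^ i / ((q ^ (j + m))⁻¹ * z / α * q ^ j) = (q ^ i)⁻¹ * α / w := by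
    rw [pow_add]; field_simp
  have e₃ : z / (w * q ^ m) / q ^ i / ((q ^ (j + m))⁻¹ * z / β * q ^ i') = (q ^ m)⁻¹ * β / w := by
    rw [hpow]; field_simp
  have e₄ : (q ^ (j + m))⁻¹ * z / β / (z / (w * q ^ m) / q ^ i * q ^ i) = (q ^ j)⁻¹ * w / β := by
    rw [pow_add]; field_simp
  have ha₁₁ : q / (α / z * q ^ (j + m)) / (z / (α * β) * (q / q ^ (j + m) * z)) = β / z := by
    field_simp
  have ha₁₂ : q / (α / z * q ^ (j + m)) / (z / (α * β)) = q / (1 / β * q ^ (j + m)) := by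
    field_simp
  have ha₁₃ : q / (α / z * q ^ (j + m)) / (q / q ^ (j + m) * z) = 1 / α := by
    field_simp
  have ha₁₄ : q / (α / z * q ^ (j + m)) * q ^ (j + m) = q * z / α := by
    field_simp
  have ha₂₁ : q / (β / z * q ^ (j + m)) / (z / (α * β) * (q / q ^ (j + m) * z)) = α / z := by
    field_simp
  have ha₂₂ : q / (β / z * q ^ (j + m)) / (z / (α * β)) = q / (1 / α * q ^ (j + m)) := by
    field_simp
  have ha₂₃ : q / (β / z * q ^ (j + m)) / (q / q ^ (j + m) * z) = 1 / β := by
    field_simp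
  have ha₂₄ : q / (β / z * q ^ (j + m)) * q ^ (j + m) = q * z / β := by
    field_simp
  have hl₁ : q / (w / z * q ^ m) / q ^ i / (z / (α * β) * (q / q ^ (j + m) * z)) =
      α * β / (z * w) * q ^ j / q ^ i := by
    rw [pow_add]; field_simp
  have hl₂ : q / (w / z * q ^ m) / q ^ i / (z / (α * β)) = q / (w / (α * β) * q ^ m) / q ^ i := by
    field_simp
  have hl₃ : q / (w / z * q ^ m) / q ^ i / (q / q ^ (j + m) * z) = 1 / w * q ^ j / q ^ i := by
    rw [pow_add]; field_simp
  have hp₁ : q / q ^ (j + m) * z / α = q / (α / z * q ^ (j + m)) := by field_simp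
  have hp₂ : q / q ^ (j + m) * w = q / (1 / w * q ^ (j + m)) := by field_simp
  have hp₃ : q / q ^ (j + m) * β = q / (1 / β * q ^ (j + m)) := by field_simp
  have hp₄ : q / q ^ (j + m) * z * w / (α * β) = q / (α * β / (z * w) * q ^ (j + m)) := by field_simp
  have hp₅ : q / q ^ (j + m) * α * β / w = q / (w / (α * β) * q ^ (j + m)) := by field_simp
  have hp₆ : q / q ^ (j + m) * z / w = q / (w / z * q ^ (j + m)) := by field_simp
  simp only [zpow_neg, zpow_sub₀ hq, zpow_natCast, zpow_one, add_tsub_cancel_left]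
  rw [hm_div, hi_div, hn, ← e₁]
  rw [vwpW_swap, min_comm, e₃, e₄] at second
  rw [e₂] at first
  simp only [ha₁, ha₂, hl] at first second
  simp only [ha₁₁, ha₁₂, ha₁₃, ha₁₄, ha₂₁, ha₂₂, ha₂₃, ha₂₄, hl₁, hl₂, hl₃] at first second
  rw [first, second, ← mul_assoc, prefactor, hp₁, hp₂, hp₃, hp₄, hp₅, hp₆,
    vwpW_swap, min_comm]

end DoubleBailey

section Genericity

open MvPolynomial

lemma eq_zero_of_prod_X_zpow_eq_one {σ R K : Type*} [Fintype σ] [CommRing R] [IsDomain R]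
    [Field K] [Algebra (MvPolynomial σ R) K] [IsFractionRing (MvPolynomial σ R) K] {a : σ → ℤ}
    (h : ∏ i, algebraMap (MvPolynomial σ R) K (X i) ^ a i = 1) : a = 0 := by
  have hinj := IsFractionRing.injective (MvPolynomial σ R) K
  have hX (i : σ) : algebraMap (MvPolynomial σ R) K (X i) ≠ 0 :=
    (map_ne_zero_iff _ hinj).2 (X_ne_zero i)
  have hprod (b : σ → ℕ) : ∏ i, (X i : MvPolynomial σ R) ^ b i =
      monomial (Finsupp.equivFunOnFinite.symm b) 1 := by
    rw [monomial_eq, C_1, one_mul, Finsupp.prod_fintype _ _ (by simp)]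
    rfl
  have key : ∏ i, (X i : MvPolynomial σ R) ^ (a i).toNat = ∏ i, X i ^ (-a i).toNat := by
    apply hinj
    simp only [map_prod, map_pow]
    rw [← one_mul (∏ i, _ ^ (-a i).toNat), ← h, ← prod_mul_distrib]
    refine prod_congr rfl fun i _ => ?_
    rw [← zpow_natCast, ← zpow_natCast, ← zpow_add₀ (hX i)]
    congr 1
    omega
  rw [hprod, hprod] at key
  have := Finsupp.equivFunOnFinite.symm.injective (monomial_left_injective one_ne_zero key)
  ext i
  have := congrFun this i
  simp only [Pi.zero_apply]
  omega

end Genericity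

/-- Proposition D.14: the double Bailey transformation of the terminating
very-well-poised balanced `₁₀φ₉` series. -/
theorem statement12
    (q z α β w : F12)
    (hq : q = algebraMap (MvPolynomial (Fin 5) ℚ) F12 (MvPolynomial.X 0))
    (hz : z = algebraMap (MvPolynomial (Fin 5) ℚ) F12 (MvPolynomial.X 1))
    (hα : α = algebraMap (MvPolynomial (Fin 5) ℚ) F12 (MvPolynomial.X 2))
    (hβ : β = algebraMap (MvPolynomial (Fin 5) ℚ) F12 (MvPolynomial.X 3))
    (hw : w = algebraMap (MvPolynomial (Fin 5) ℚ) F12 (MvPolynomial.X 4)) :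
    ∀ n i j : ℕ, i ≤ n → j ≤ n →
      vwpW q (q ^ (-(n : ℤ)) * z / α)
          (q ^ (-(i : ℤ))) (q ^ (-(j : ℤ)))
          (q ^ ((i : ℤ) - (n : ℤ)) * w / α) (q ^ ((j : ℤ) - (n : ℤ)) * β / w)
          (z / (α * β)) (q * z / α) (q ^ (1 - (n : ℤ)) * z)
          (min i j) =
        ((qPoch q (1 / α) n * qPoch q (1 / β) n * qPoch q (w / z) n *
              qPoch q (α * β / (z * w)) n /
            (qPoch q (α / z) n * qPoch q (β / z) n * qPoch q (1 / w) n *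
              qPoch q (w / (α * β)) n)) *
          (qPoch q (β / z) i * qPoch q (w / (α * β)) i * qPoch q (q ^ (1 - (n : ℤ)) * z / α) i *
              qPoch q (q ^ (1 - (n : ℤ)) * w) i /
            (qPoch q (1 / α) i * qPoch q (w / z) i * qPoch q (q ^ (1 - (n : ℤ)) * β) i *
              qPoch q (q ^ (1 - (n : ℤ)) * z * w / (α * β)) i)) *
          (qPoch q (β / z) j * qPoch q (1 / w) j * qPoch q (q ^ (1 - (n : ℤ)) * z / α) j *
              qPoch q (q ^ (1 - (n : ℤ)) * α * β / w) j /
            (qPoch q (1 / α) j * qPoch q (α * β / (z * w)) j * qPoch q (q ^ (1 - (n : ℤ)) * β) j *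
              qPoch q (q ^ (1 - (n : ℤ)) * z / w) j))) *
        vwpW q (q ^ (-(n : ℤ)) * z / β)
          (q ^ ((i : ℤ) - (n : ℤ))) (q ^ ((j : ℤ) - (n : ℤ)))
          (q ^ (-(i : ℤ)) * α / w) (q ^ (-(j : ℤ)) * w / β)
          (z / (α * β)) (q * z / β) (q ^ (1 - (n : ℤ)) * z)
          (min (n - i) (n - j)) := by
  have hind (a b c d e : ℤ) (h : q ^ a * z ^ b * α ^ c * β ^ d * w ^ e = 1) :
      a = 0 ∧ b = 0 ∧ c = 0 ∧ d = 0 ∧ e = 0 := by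
    have := eq_zero_of_prod_X_zpow_eq_one (R := ℚ) (K := F12) (a := ![a, b, c, d, e])
      (by rw [Fin.prod_univ_five, ← hq, ← hz, ← hα, ← hβ, ← hw]; exact h)
    simpa using this
  have hX (i : Fin 5) : algebraMap (MvPolynomial (Fin 5) ℚ) F12 (MvPolynomial.X i) ≠ 0 :=
    (map_ne_zero_iff _ (IsFractionRing.injective _ _)).2 (MvPolynomial.X_ne_zero i)
  have hq₀ : q ≠ 0 := hq ▸ hX 0
  have hz₀ : z ≠ 0 := hz ▸ hX 1
  have hα₀ : α ≠ 0 := hα ▸ hX 2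
  have hβ₀ : β ≠ 0 := hβ ▸ hX 3
  have hw₀ : w ≠ 0 := hw ▸ hX 4
  have hmon {x : F12} (b c d e : ℤ) (h : x = z ^ b * α ^ c * β ^ d * w ^ e)
      (hne : ¬(b = 0 ∧ c = 0 ∧ d = 0 ∧ e = 0)) : NonResonant q x := fun k hk =>
    hne (hind k b c d e (by rw [← hk, h]; ring)).2
  have hr (k : ℕ) (hk : 0 < k) : q ^ k ≠ 1 := fun h =>
    hk.ne' (by simpa using (hind k 0 0 0 0 (by simpa using h)).1)
  intro n i j hi hj
  exact vwpW_double_bailey hq₀ hr hz₀ hα₀ hβ₀ hw₀ (hmon 0 1 0 0 (by simp) (by simp))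
    (hmon 0 0 1 0 (by simp) (by simp)) (hmon 0 0 0 1 (by simp) (by simp))
    (hmon 1 (-1) 0 0 (by simp; rfl) (by simp)) (hmon 1 0 (-1) 0 (by simp; rfl) (by simp))
    (hmon 1 0 0 (-1) (by simp; rfl) (by simp)) (hmon 0 (-1) 0 1 (by simp; ring) (by simp))
    (hmon 0 0 (-1) 1 (by simp; ring) (by simp)) (hmon 0 (-1) (-1) 1 (by simp; ring) (by simp))
    (hmon 1 (-1) (-1) 1 (by simp; ring) (by simp)) hi hj
end

section
/- Let F be a field, q ∈ F nonzero, s ≥ 1 an integer, and k₁,…,k_s ≥ 1 integers with N := k₁+⋯+k_s. Let z₁,…,z_N ∈ F be pairwise distinct and let f₁,…,f_s : F → F be arbitrary functions. Let a : {1,…,N} → {1,…,s} be defined by a(i) = the unique index a with k₁+⋯+k_{a−1} < i ≤ k₁+⋯+k_a. Define [k]_{q^{−1}}! := ∏_{j=1}^{k} (1 + q^{−1} + q^{−2} + ⋯ + q^{−(j−1)}). Then Σ_{σ ∈ S_N} ∏_{i=1}^{N} f_{a(i)}(z_{σ(i)}) · ∏_{1 ≤ i < j ≤ N} (z_{σ(i)}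 − q^{−1} z_{σ(j)})/(z_{σ(i)} − z_{σ(j)}) = (∏_{a=1}^{s} [k_a]_{q^{−1}}!) · Σ_{(I₁,…,I_s)} ∏_{a=1}^{s} ∏_{i ∈ I_a} f_a(z_i) · ∏_{1 ≤ a < b ≤ s} ∏_{i ∈ I_a} ∏_{j ∈ I_b} (z_i − q^{−1} z_j)/(z_i − z_j), where the sum on the right runs over all ordered set partitions I₁ ⊔ ⋯ ⊔ I_s = {1,…,N} with |I_a| = k_a. -/
open Finset

open Polynomial in
/-- For pairwise distinct points `v i`, the sum over `p` of the products of the weights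
`(v p - t * v j) / (v p - v j)` over `j ≠ p` is the `t`-integer of the number of points. -/
theorem sum_prod_div_sub_eq_geom_sum {F ι : Type*} [Field F] [DecidableEq ι] (t : F) {v : ι → F}
    (hv : Function.Injective v) (S : Finset ι) :
    ∑ p ∈ S, ∏ j ∈ S.erase p, (v p - t * v j) / (v p - v j) = ∑ r ∈ range #S, t ^ r := by
  have key : ∀ S : Finset ι, S.Nonempty → ∃ P : F[X], P.natDegree ≤ #S - 1 ∧
      P.coeff (#S - 1) = ∑ r ∈ range #S, t ^ r ∧
      ∀ p ∈ S, P.eval (v p) = ∏ j ∈ S.erase p, (v p - t * v j) := by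
    intro S hS
    induction hS using Finset.Nonempty.cons_induction with
    | singleton a => exact ⟨1, by simp, by simp, by simp⟩
    | cons a S ha hS ih =>
      obtain ⟨P, hdeg, hcoeff, heval⟩ := ih
      obtain ⟨m, hm⟩ : ∃ m, #S = m + 1 := ⟨#S - 1, by have := hS.card_pos; omega⟩
      have hmonic : (∏ j ∈ S, (X - C (t * v j))).Monic := monic_prod_X_sub_C _ _
      have hnat : (∏ j ∈ S, (X - C (t * v j))).natDegree = m + 1 := by
        rw [natDegree_finsetProd_X_sub_C_eq_card, hm]
      simp only [hm, Nat.add_sub_cancel] at hdeg hcoeff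
      refine ⟨∏ j ∈ S, (X - C (t * v j)) + C t * ((X - C (v a)) * P), ?_, ?_, ?_⟩
      · rw [card_cons, hm, Nat.add_sub_cancel]
        refine natDegree_add_le_of_degree_le hnat.le ((natDegree_C_mul_le _ _).trans ?_)
        refine natDegree_mul_le.trans ?_
        rw [natDegree_X_sub_C]
        omega
      · rw [card_cons, hm, Nat.add_sub_cancel, coeff_add, coeff_C_mul, sub_mul, coeff_sub,
          coeff_X_mul, coeff_C_mul, coeff_eq_zero_of_natDegree_lt (Nat.lt_succ_of_le hdeg),
          hcoeff, sum_range_succ' _ (m + 1), ← hnat, hmonic.coeff_natDegree, mul_zero, sub_zero,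
          mul_sum, add_comm]
        simp [pow_succ']
      · intro p hp
        rw [mem_cons] at hp
        simp only [eval_add, eval_prod, eval_sub, eval_X, eval_C, eval_mul]
        rcases hp with rfl | hp
        · simp [erase_eq_of_notMem ha]
        · have hne : p ≠ a := fun h => ha (h ▸ hp)
          rw [heval p hp, cons_eq_insert, erase_insert_of_ne hne.symm,
            prod_insert (fun h => ha (mem_of_mem_erase h)), ← mul_prod_erase S _ hp]
          ring
  rcases S.eq_empty_or_nonempty with rfl | hS
  · simp
  obtain ⟨P, hdeg, hcoeff, heval⟩ := key S hS
  have hlt : P.degree < #S := by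
    refine (degree_le_of_natDegree_le hdeg).trans_lt ?_
    have := hS.card_pos
    exact_mod_cast (by omega : #S - 1 < #S)
  rw [← hcoeff, Lagrange.coeff_eq_sum hv.injOn hlt]
  refine sum_congr rfl fun p hp => ?_
  rw [heval p hp, prod_div_distrib]

/-- The `t`-factorial of `m`. -/
def tFactorial {F : Type*} [Field F] (t : F) (m : ℕ) : F :=
  ∏ l ∈ range m, ∑ r ∈ range (l + 1), t ^ r

theorem tFactorial_succ {F : Type*} [Field F] (t : F) (m : ℕ) :
    tFactorial t (m + 1) = tFactorial t m * ∑ r ∈ range (m + 1), t ^ r :=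
  prod_range_succ _ _

theorem Fin.prod_univ_swap_succ {M : Type*} [CommMonoid M] {n : ℕ} (p : Fin (n + 1))
    (h : Fin (n + 1) → M) :
    ∏ i, h i = h p * ∏ i : Fin n, h (Equiv.swap 0 p i.succ) := by
  rw [← Equiv.prod_comp (Equiv.swap 0 p) h, Fin.prod_univ_succ, Equiv.swap_apply_left]

theorem card_filter_eq_swap_succ {α : Type*} [DecidableEq α] {n : ℕ} (p : Fin (n + 1))
    (g : Fin (n + 1) → α) (b : α) :
    #{i | g i = b} = #{i : Fin n | g (Equiv.swap 0 p i.succ) = b} + if b = g p then 1 else 0 := by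
  simp only [card_filter]
  rw [← Equiv.sum_comp (Equiv.swap 0 p), Fin.sum_univ_succ, Equiv.swap_apply_left, add_comm]
  simp only [eq_comm]

theorem prod_tFactorial_card_fiber_succ {F : Type*} [Field F] (t : F) {s n : ℕ}
    (a : Fin (n + 1) → Fin s) :
    ∏ b, tFactorial t #{i | a i = b} =
      (∏ b, tFactorial t #{i : Fin n | a i.succ = b}) *
        ∑ r ∈ range #{i | a i = a 0}, t ^ r := by
  have h : ∀ b, tFactorial t #{i | a i = b} = tFactorial t #{i : Fin n | a i.succ = b} *
      if b = a 0 then ∑ r ∈ range #{i | a i = b}, t ^ r else 1 := by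
    intro b
    have hb := card_filter_eq_swap_succ 0 a b
    simp only [Equiv.swap_self, Equiv.refl_apply] at hb
    rw [hb]
    split_ifs with h
    · exact tFactorial_succ _ _
    · simp
  simp only [h, prod_mul_distrib, prod_ite_eq', mem_univ, if_true]

/-- The weight sum over the permutations which rearrange a labelling `g` into a monotone
labelling `a`: pairs with distinct labels factor out, and each label class contributes a
`t`-factorial. -/
theorem sum_perm_prod_weight {F : Type*} [Field F] (t : F) {s : ℕ} (n : ℕ)
    (w : Fin n → Fin n → F)
    (hw : ∀ S : Finset (Fin n),
      ∑ p ∈ S, ∏ j ∈ S.erase p, w p j = ∑ r ∈ range #S, t ^ r)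
    (g a : Fin n → Fin s) (ha : Monotone a)
    (hcard : ∀ b, #{i | g i = b} = #{i | a i = b}) :
    ∑ σ : Equiv.Perm (Fin n), (if ∀ i, g (σ i) = a i then
        ∏ i, ∏ j, if i < j then w (σ i) (σ j) else 1 else 0) =
      (∏ b, tFactorial t #{i | a i = b}) * ∏ i, ∏ j, if g i < g j then w i j else 1 := by
  induction n with
  | zero => simp [tFactorial]
  | succ n ih =>
    have hmin : ∀ i, a 0 ≤ g i := by
      intro i
      have : 0 < #{j | a j = g i} := by
        rw [← hcard]
        exact card_pos.2 ⟨i, by simp⟩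
      obtain ⟨j, hj⟩ := card_pos.1 this
      rw [← (mem_filter.1 hj).2]
      exact ha (Fin.zero_le j)
    have step : ∀ p, ∑ e : Equiv.Perm (Fin n),
        (if ∀ i, g (Equiv.Perm.decomposeFin.symm (p, e) i) = a i then
          ∏ i, ∏ j, if i < j then w (Equiv.Perm.decomposeFin.symm (p, e) i)
            (Equiv.Perm.decomposeFin.symm (p, e) j) else 1 else 0) =
        if g p = a 0 then (∏ j ∈ (univ.filter fun i => g i = a 0).erase p, w p j) *
          ((∏ b, tFactorial t #{i : Fin n | a i.succ = b}) *
            ∏ i, ∏ j, if g i < g j then w i j else 1) else 0 := by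
      intro p
      by_cases hp : g p = a 0
      swap
      · rw [if_neg hp]
        refine sum_eq_zero fun e _ => if_neg fun h => hp ?_
        simpa using h 0
      rw [if_pos hp]
      set φ : Fin n → Fin (n + 1) := fun i => Equiv.swap 0 p i.succ with hφ
      have hφinj : Function.Injective φ :=
        (Equiv.swap 0 p).injective.comp (Fin.succ_injective n)
      have IH := ih (fun i j => w (φ i) (φ j)) (fun S => by
          rw [← card_map ⟨φ, hφinj⟩, ← hw, sum_map]
          refine sum_congr rfl fun i _ => ?_
          rw [← map_erase, prod_map]
          rfl) (fun i => g (φ i)) (fun i => a i.succ)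
        (fun i j h => ha (Fin.succ_le_succ_iff.2 h)) (fun b => by
          have h1 := card_filter_eq_swap_succ p g b
          have h2 := card_filter_eq_swap_succ 0 a b
          simp only [Equiv.swap_self, Equiv.refl_apply] at h2
          rw [hp] at h1
          have h3 := hcard b
          simp only [hφ]
          omega)
      have hrow : ∏ i, w p (φ i) =
          (∏ j ∈ (univ.filter fun i => g i = a 0).erase p, w p j) *
            ∏ i, if g p < g (φ i) then w p (φ i) else 1 := by
        have h1 : ∏ j ∈ (univ.filter fun i => g i = a 0).erase p, w p j =
            ∏ i, if g (φ i) = a 0 then w p (φ i) else 1 := by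
          have : ∏ j ∈ (univ.filter fun i => g i = a 0).erase p, w p j =
              ∏ j, if j ≠ p ∧ g j = a 0 then w p j else 1 := by
            rw [← prod_filter]
            refine prod_congr ?_ fun _ _ => rfl
            ext j
            simp
          rw [this, Fin.prod_univ_swap_succ p, if_neg (by simp), one_mul]
          refine prod_congr rfl fun i _ => ?_
          have hne : φ i ≠ p := by
            intro h
            have h' : Equiv.swap 0 p i.succ = Equiv.swap 0 p 0 := by
              rw [Equiv.swap_apply_left]
              exact h
            exact Fin.succ_ne_zero i ((Equiv.swap 0 p).injective h')
          simp only [hφ] at hne ⊢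
          simp [hne]
        rw [h1, ← prod_mul_distrib]
        refine prod_congr rfl fun i _ => ?_
        rcases (hmin (φ i)).eq_or_lt with h | h
        · rw [if_pos h.symm, if_neg (by rw [hp, ← h]; exact lt_irrefl _), mul_one]
        · rw [if_neg h.ne', if_pos (by rwa [hp]), one_mul]
      have hsplit : (∏ i, ∏ j, if g i < g j then w i j else 1) =
          (∏ i, if g p < g (φ i) then w p (φ i) else 1) *
            ∏ i, ∏ j, if g (φ i) < g (φ j) then w (φ i) (φ j) else 1 := by
        rw [Fin.prod_univ_swap_succ p, Fin.prod_univ_swap_succ p, if_neg (lt_irrefl _), one_mul]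
        congr 1
        refine prod_congr rfl fun i _ => ?_
        rw [Fin.prod_univ_swap_succ p, if_neg (by rw [hp]; exact (hmin _).not_gt), one_mul]
      have hterm : ∀ e : Equiv.Perm (Fin n),
          (if ∀ i, g (Equiv.Perm.decomposeFin.symm (p, e) i) = a i then
            ∏ i, ∏ j, if i < j then w (Equiv.Perm.decomposeFin.symm (p, e) i)
              (Equiv.Perm.decomposeFin.symm (p, e) j) else 1 else 0) =
          (∏ i, w p (φ i)) * if ∀ i, g (φ (e i)) = a i.succ then
            ∏ i, ∏ j, if i < j then w (φ (e i)) (φ (e j)) else 1 else 0 := by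
        intro e
        rw [← Equiv.prod_comp e fun i => w p (φ i), mul_ite, mul_zero]
        simp [Fin.forall_fin_succ, Fin.prod_univ_succ, hp, hφ]
      rw [sum_congr rfl fun e _ => hterm e, ← mul_sum, IH, hrow, hsplit]
      ring
    rw [← Equiv.sum_comp Equiv.Perm.decomposeFin.symm, Fintype.sum_prod_type,
      sum_congr rfl fun p _ => step p, ← sum_filter, ← sum_mul, hw, hcard,
      prod_tFactorial_card_fiber_succ]
    ring

/-- A labelling of `Fin (∑ b, k b)` by consecutive blocks of lengths `k b` is monotone, and its
fibers have cardinalities `k b`. -/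
theorem monotone_and_card_fiber_of_blocks {s N : ℕ} (k : Fin s → ℕ) (hN : N = ∑ b, k b)
    (a : Fin N → Fin s)
    (ha : ∀ i : Fin N, ∑ b with b < a i, k b ≤ (i : ℕ) ∧
      (i : ℕ) < ∑ b with b < a i, k b + k (a i)) :
    Monotone a ∧ ∀ b, #{i | a i = b} = k b := by
  refine ⟨fun i j hij => ?_, ?_⟩
  · by_contra! h
    have h1 : ∑ b with b < a j, k b + k (a j) ≤ ∑ b with b < a i, k b := by
      rw [add_comm, ← sum_insert (by simp)]
      refine sum_le_sum_of_subset fun b hb => ?_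
      rcases mem_insert.1 hb with rfl | hb
      · simpa using h
      · simpa using (mem_filter.1 hb).2.trans h
    have h2 := (ha i).1
    have h3 := (ha j).2
    have h4 : (i : ℕ) ≤ j := hij
    omega
  · have hle : ∀ b ∈ univ, #{i | a i = b} ≤ k b := by
      intro b _
      calc #{i | a i = b} ≤ #(Ico (∑ c with c < b, k c) (∑ c with c < b, k c + k b)) := by
            refine card_le_card_of_injOn (fun i => (i : ℕ)) ?_ (Fin.val_injective.injOn)
            intro i hi
            have hi : a i = b := by simpa using hi
            subst hi
            simpa using ha i
        _ = k b := by simp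
    have hsum : ∑ b, #{i | a i = b} = ∑ b, k b := by
      rw [← hN, ← card_eq_sum_card_fiberwise (fun _ _ => mem_coe.2 (mem_univ _))]
      simp
    intro b
    exact (sum_eq_sum_iff_of_le hle).1 hsum b (mem_univ b)

/-- Proposition G.1: the anti-symmetrization with the deformed Vandermonde
weight `Δ(q,z)`, divided by the Vandermonde determinant, of a product of single-variable
functions equals a factorized sum over ordered set partitions `I₁ ⊔ ⋯ ⊔ I_s = {1,…,N}`
with `|I_a| = k_a`, weighted by `∏_a [k_a]_{q⁻¹}!`. -/
theorem statement15 {F : Type*} [Field F] (q : F) (hq : q ≠ 0)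
    (s : ℕ) (hs : 1 ≤ s) (k : Fin s → ℕ) (hk : ∀ a, 1 ≤ k a)
    (N : ℕ) (hN : N = ∑ a, k a)
    (z : Fin N → F) (hz : Function.Injective z)
    (f : Fin s → F → F)
    (a : Fin N → Fin s)
    (ha : ∀ i : Fin N,
      (∑ b ∈ Finset.univ.filter (fun b => b < a i), k b) ≤ (i : ℕ) ∧
      (i : ℕ) < (∑ b ∈ Finset.univ.filter (fun b => b < a i), k b) + k (a i)) :
    ∑ σ : Equiv.Perm (Fin N),
      ((∏ i, f (a i) (z (σ i))) *
        ∏ i, ∏ j,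
          if i < j then (z (σ i) - q⁻¹ * z (σ j)) / (z (σ i) - z (σ j)) else 1) =
    (∏ b : Fin s, ∏ m ∈ Finset.range (k b), ∑ t ∈ Finset.range (m + 1), (q⁻¹) ^ t) *
      ∑ g ∈ Finset.univ.filter
          (fun g : Fin N → Fin s =>
            ∀ b, (Finset.univ.filter (fun i => g i = b)).card = k b),
        ((∏ i, f (g i) (z i)) *
          ∏ i, ∏ j, if g i < g j then (z i - q⁻¹ * z j) / (z i - z j) else 1) := by
  obtain ⟨hmono, hfib⟩ := monotone_and_card_fiber_of_blocks k hN a ha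
  set w : Fin N → Fin N → F := fun i j => (z i - q⁻¹ * z j) / (z i - z j) with hwdef
  have hlabel : ∀ σ : Equiv.Perm (Fin N),
      ((∏ i, f (a i) (z (σ i))) * ∏ i, ∏ j, if i < j then w (σ i) (σ j) else 1) =
      ∑ g ∈ univ.filter (fun g : Fin N → Fin s => ∀ b, #{i | g i = b} = k b),
        (∏ i, f (g i) (z i)) * if ∀ i, g (σ i) = a i then
          ∏ i, ∏ j, if i < j then w (σ i) (σ j) else 1 else 0 := by
    intro σ
    rw [sum_eq_single (fun i => a (σ.symm i))]
    · rw [← Equiv.prod_comp σ fun i => f (a (σ.symm i)) (z i)]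
      simp
    · intro g _ hg
      rw [if_neg, mul_zero]
      intro h
      refine hg (funext fun i => ?_)
      rw [← h, Equiv.apply_symm_apply]
    · intro h
      refine absurd (mem_filter.2 ⟨mem_univ _, fun b => ?_⟩) h
      rw [← hfib b, card_filter, card_filter, ← Equiv.sum_comp σ]
      simp
  rw [sum_congr rfl fun σ _ => hlabel σ, sum_comm, mul_sum]
  refine sum_congr rfl fun g hg => ?_
  have hcard : ∀ b, #{i | g i = b} = #{i | a i = b} := fun b => by
    rw [hfib, (mem_filter.1 hg).2 b]
  rw [← mul_sum, sum_perm_prod_weight q⁻¹ N w (sum_prod_div_sub_eq_geom_sum q⁻¹ hz) g a hmono hcard]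
  simp only [hfib, tFactorial]
  ring
end
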